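/- (Duren's theorem for the unit ball) Let n ≥ 1, let μ be a finite positive Borel measure on B_n, and let 0 < p < q < ∞. Then there exists C > 0 such that ∫_{B_n} |f(z)|^q dμ(z) ≤ C ‖f‖_{H^p}^q for every f ∈ H^p if and only if μ is a q/p-Carleson measure. -/

import Mathlib

open MeasureTheory Metric Set Filter
open scoped ENNReal NNReal Topology

noncomputable section

/-- ℂⁿ with its Euclidean (Hermitian) structure. -/
abbrev En (n : ℕ) := EuclideanSpace ℂ (Fin n)

instance (n : ℕ) : MeasurableSpace (En n) := borel _
instance (n : ℕ) : BorelSpace (En n) := ⟨rfl⟩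

/-- The open unit ball `B_n` of ℂⁿ. -/
def Bn (n : ℕ) : Set (En n) := Metric.ball 0 1

/-- The unit sphere `S_n = ∂B_n`. -/
def Sn (n : ℕ) : Set (En n) := Metric.sphere 0 1

/-- The Hermitian inner product `⟨z,w⟩ = ∑ z_k * conj (w_k)`. -/
def herm {n : ℕ} (z w : En n) : ℂ := ∑ k, z k * (starRingEnd ℂ) (w k)

/-- The surface measure on the unit sphere, normalized so that `σ(S_n) = 1`
(the `(2n-1)`-dimensional Hausdorff measure restricted to the sphere, normalized). -/
def sigmaS (n : ℕ) : Measure (En n) :=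
  ((μH[(2 * n - 1 : ℝ)] (Sn n))⁻¹) • (μH[(2 * n - 1 : ℝ)]).restrict (Sn n)

/-- Lebesgue measure on the unit ball, normalized so that `v(B_n) = 1`. -/
def volN (n : ℕ) : Measure (En n) :=
  ((volume (Bn n))⁻¹) • volume.restrict (Bn n)

/-- The radial derivative `Rg(z) = ∑ z_k ∂g/∂z_k (z) = (Dg)(z)[z]`. -/
def radD {n : ℕ} (g : En n → ℂ) (z : En n) : ℂ := fderiv ℂ g z z

/-- The Volterra-type integration operator `J_g f(z) = ∫₀¹ f(tz) Rg(tz) dt/t`. -/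
def J {n : ℕ} (g f : En n → ℂ) (z : En n) : ℂ :=
  ∫ t in Set.Ioo (0 : ℝ) 1, f (t • z) * radD g (t • z) / (t : ℂ)

/-- The Hardy space quasinorm `‖f‖_{H^p}`, with values in `ℝ≥0∞`:
`‖f‖_{H^p}^p = sup_{0<r<1} ∫_{S_n} |f(rζ)|^p dσ(ζ)`. -/
def hNorm (n : ℕ) (p : ℝ) (f : En n → ℂ) : ℝ≥0∞ :=
  (⨆ r ∈ Set.Ioo (0 : ℝ) 1,
    ∫⁻ ζ, (‖f (r • ζ)‖₊ : ℝ≥0∞) ^ p ∂(sigmaS n)) ^ (1 / p)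

/-- Membership in the Hardy space `H^p(B_n)`. -/
def MemHp (n : ℕ) (p : ℝ) (f : En n → ℂ) : Prop :=
  DifferentiableOn ℂ f (Bn n) ∧ hNorm n p f < ⊤

/-- The Carleson box `B_δ(ζ) = {z ∈ B_n : |1 - ⟨z,ζ⟩| < δ}`. -/
def cBox {n : ℕ} (ζ : En n) (δ : ℝ) : Set (En n) :=
  {z ∈ Bn n | ‖(1 : ℂ) - herm z ζ‖ < δ}

/-- The measure `dμ_g(z) = |Rg(z)|²(1-|z|²) dv(z)`. -/
def muJ (n : ℕ) (g : En n → ℂ) : Measure (En n) :=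
  (volN n).withDensity
    (fun z => (‖radD g z‖₊ : ℝ≥0∞) ^ 2 * ENNReal.ofReal (1 - ‖z‖ ^ 2))

/-- The admissible approach region `Γ_α(ζ) = {z ∈ B_n : |1-⟨z,ζ⟩| < (α/2)(1-|z|²)}`. -/
def Gam {n : ℕ} (α : ℝ) (ζ : En n) : Set (En n) :=
  {z ∈ Bn n | ‖(1 : ℂ) - herm z ζ‖ < α / 2 * (1 - ‖z‖ ^ 2)}

open Classical in
/-- The involutive automorphism `φ_a` of the unit ball interchanging `0` and `a`:
`φ_a(z) = (a - P_a z - √(1-|a|²) (z - P_a z)) / (1 - ⟨z,a⟩)`, where `P_a` is the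
orthogonal projection onto `ℂa`. -/
def mob {n : ℕ} (a z : En n) : En n :=
  if a = 0 then -z
  else ((1 : ℂ) - herm z a)⁻¹ •
    ((a - (herm z a / herm a a) • a) -
      ((Real.sqrt (1 - ‖a‖ ^ 2) : ℂ)) • (z - (herm z a / herm a a) • a))

/-- The norm of the invariant (real) gradient `∇̃f(z) = ∇(f ∘ φ_z)(0)`. -/
def invGrad {n : ℕ} {F : Type*} [NormedAddCommGroup F] [NormedSpace ℝ F]
    (f : En n → F) (z : En n) : ℝ :=
  ‖fderiv ℝ (fun w => f (mob z w)) 0‖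

/-- The invariant measure `dλ_n(z) = (1-|z|²)^{-(n+1)} dv(z)`. -/
def lamN (n : ℕ) : Measure (En n) :=
  (volN n).withDensity (fun z => ENNReal.ofReal ((1 - ‖z‖ ^ 2) ^ (-(n + 1 : ℝ))))

/-- The invariant Poisson integral `u_φ(z) = ∫_{S_n} φ(ζ) (1-|z|²)ⁿ/|1-⟨z,ζ⟩|^{2n} dσ(ζ)`. -/
def poisson (n : ℕ) (φ : En n → ℝ) (z : En n) : ℝ :=
  ∫ ζ, φ ζ * ((1 - ‖z‖ ^ 2) ^ n / ‖(1 : ℂ) - herm z ζ‖ ^ (2 * n)) ∂(sigmaS n)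

/-- The function `μ̃(ζ) = ∫_{Γ_α(ζ)} (1-|z|²)^{-n} dμ(z)`. -/
def tildeMu (n : ℕ) (α : ℝ) (μ : Measure (En n)) (ζ : En n) : ℝ≥0∞ :=
  ∫⁻ z in Gam α ζ, ENNReal.ofReal ((1 - ‖z‖ ^ 2) ^ (-(n : ℝ))) ∂μ

/-- The `L^{p/(p-s)}(S_n)`-norm of `μ̃`. -/
def tildeMuNorm (n : ℕ) (α p s : ℝ) (μ : Measure (En n)) : ℝ≥0∞ :=
  (∫⁻ ζ, tildeMu n α μ ζ ^ (p / (p - s)) ∂(sigmaS n)) ^ ((p - s) / p)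


/-- `μ` is an `s`-Carleson measure on `B_n`: `μ(B_δ(ζ)) ≤ C δ^{ns}`. -/
def IsSCarleson (n : ℕ) (s : ℝ) (μ : Measure (En n)) : Prop :=
  ∃ C : ℝ≥0∞, C < ⊤ ∧
    ∀ ζ ∈ Sn n, ∀ δ > (0 : ℝ), μ (cBox ζ δ) ≤ C * ENNReal.ofReal (δ ^ ((n : ℝ) * s))

theorem herm_eq_inner {n : ℕ} (z w : En n) : herm z w = inner ℂ w z := by
  simp [herm, PiLp.inner_apply]

theorem herm_self {n : ℕ} (z : En n) : herm z z = (‖z‖ : ℂ) ^ 2 := by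
  rw [herm_eq_inner, inner_self_eq_norm_sq_to_K]; simp

theorem conj_herm {n : ℕ} (z w : En n) : (starRingEnd ℂ) (herm z w) = herm w z := by
  simp only [herm_eq_inner, inner_conj_symm]

theorem norm_herm_le {n : ℕ} (z w : En n) : ‖herm z w‖ ≤ ‖z‖ * ‖w‖ := by
  rw [herm_eq_inner, mul_comm]; exact norm_inner_le_norm w z

theorem herm_smul_left {n : ℕ} (c : ℂ) (z w : En n) : herm (c • z) w = c * herm z w := by
  simp only [herm_eq_inner, inner_smul_right]

theorem herm_smul_right {n : ℕ} (c : ℂ) (z w : En n) :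
    herm z (c • w) = (starRingEnd ℂ) c * herm z w := by
  simp only [herm_eq_inner, inner_smul_left]

theorem herm_sub_left {n : ℕ} (x y w : En n) : herm (x - y) w = herm x w - herm y w := by
  simp only [herm_eq_inner, inner_sub_right]

theorem herm_sub_right {n : ℕ} (x y w : En n) : herm w (x - y) = herm w x - herm w y := by
  simp only [herm_eq_inner, inner_sub_left]

@[fun_prop]
theorem Continuous.herm {n : ℕ} {X : Type*} [TopologicalSpace X] {f g : X → En n}
    (hf : Continuous f) (hg : Continuous g) : Continuous fun x => herm (f x) (g x) := by
  simp only [herm_eq_inner]; exact hg.inner hf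

theorem norm_of_mem_Sn {n : ℕ} {ζ : En n} (h : ζ ∈ Sn n) : ‖ζ‖ = 1 := by
  simpa [Sn] using h

theorem mem_Bn {n : ℕ} {z : En n} : z ∈ Bn n ↔ ‖z‖ < 1 := by simp [Bn]

/-- The Korányi quasi-distance `|1 - ⟨z, w⟩|`. -/
def korDist {n : ℕ} (z w : En n) : ℝ := ‖(1 : ℂ) - herm z w‖

theorem korDist_comm {n : ℕ} (z w : En n) : korDist z w = korDist w z := by
  rw [korDist, korDist, ← RCLike.norm_conj, map_sub, conj_herm, map_one]

theorem korDist_nonneg {n : ℕ} (z w : En n) : 0 ≤ korDist z w := norm_nonneg _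

@[fun_prop]
theorem Continuous.korDist {n : ℕ} {X : Type*} [TopologicalSpace X] {f g : X → En n}
    (hf : Continuous f) (hg : Continuous g) : Continuous fun x => korDist (f x) (g x) := by
  unfold _root_.korDist; fun_prop

theorem one_sub_norm_le_korDist {n : ℕ} {z ζ : En n} (hζ : ‖ζ‖ ≤ 1) :
    1 - ‖z‖ ≤ korDist z ζ := by
  have h1 := norm_sub_norm_le (1 : ℂ) (herm z ζ)
  have h2 := (norm_herm_le z ζ).trans (mul_le_of_le_one_right (norm_nonneg z) hζ)
  rw [norm_one] at h1
  unfold korDist; linarith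

theorem norm_sub_sq_le_korDist {n : ℕ} {x y : En n} (hx : x ∈ Sn n) (hy : y ∈ Sn n) :
    ‖x - y‖ ^ 2 ≤ 2 * korDist x y := by
  have h1 : ‖x - y‖ ^ 2 = 2 * ((1 : ℂ) - herm x y).re := by
    rw [@norm_sub_sq ℂ, norm_of_mem_Sn hx, norm_of_mem_Sn hy, ← inner_conj_symm, ← herm_eq_inner]
    simp; ring
  have h2 := Complex.re_le_norm ((1 : ℂ) - herm x y)
  unfold korDist; linarith

/-- The nonisotropic ball `{η ∈ S_n : |1 - ⟨η, ζ⟩| < t}` on the sphere. -/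
def korBall {n : ℕ} (ζ : En n) (t : ℝ) : Set (En n) := {η ∈ Sn n | korDist η ζ < t}

theorem measurableSet_Sn (n : ℕ) : MeasurableSet (Sn n) := isClosed_sphere.measurableSet

theorem measurableSet_korBall {n : ℕ} (ζ : En n) (t : ℝ) : MeasurableSet (korBall ζ t) :=
  (measurableSet_Sn n).inter (isOpen_lt (f := fun η => korDist η ζ) (by fun_prop) continuous_const).measurableSet

section Chart

variable {m : ℕ}

/-- All real coordinates of a point of `ℂ^{m+1}` except the real part of the zeroth one. -/
def coordProj (z : En (m + 1)) : Option (Fin m × Bool) → ℝ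
  | none => (z 0).im
  | some (k, true) => (z k.succ).im
  | some (k, false) => (z k.succ).re

theorem coordProj_sub (z w : En (m + 1)) : coordProj (z - w) = coordProj z - coordProj w := by
  funext i
  match i with
  | none => simp [coordProj]
  | some (k, true) => simp [coordProj]
  | some (k, false) => simp [coordProj]

theorem norm_sq_eq_coordProj (z : En (m + 1)) :
    ‖z‖ ^ 2 = (z 0).re ^ 2 + ∑ i, coordProj z i ^ 2 := by
  rw [EuclideanSpace.norm_sq_eq, Fin.sum_univ_succ, Fintype.sum_option, Fintype.sum_prod_type]
  have h : ∀ c : ℂ, ‖c‖ ^ 2 = c.re ^ 2 + c.im ^ 2 := fun c => by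
    rw [Complex.sq_norm, Complex.normSq_apply]; ring
  simp only [Fintype.sum_bool, coordProj, h]
  rw [Finset.sum_congr rfl fun k _ => add_comm ((z (Fin.succ k)).re ^ 2) _]
  ring

theorem abs_coordProj_le (z : En (m + 1)) (i : Option (Fin m × Bool)) :
    |coordProj z i| ≤ ‖z‖ := by
  apply abs_le_of_sq_le_sq _ (norm_nonneg z)
  rw [norm_sq_eq_coordProj]
  have := Finset.single_le_sum (f := fun i => coordProj z i ^ 2) (fun i _ => sq_nonneg _)
    (Finset.mem_univ i)
  have h2 := sq_nonneg (z 0).re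
  linarith

theorem lipschitzWith_coordProj : LipschitzWith 1 (coordProj (m := m)) := by
  apply LipschitzWith.of_dist_le_mul
  intro z w
  rw [NNReal.coe_one, one_mul, dist_pi_le_iff dist_nonneg]
  intro i
  rw [Real.dist_eq, dist_eq_norm, ← Pi.sub_apply, ← coordProj_sub]
  exact abs_coordProj_le _ _

theorem norm_sub_le_coordProj {z w : En (m + 1)} (hz : z ∈ Sn (m + 1)) (hw : w ∈ Sn (m + 1))
    (hz0 : 1 / 2 ≤ (z 0).re) (hw0 : 1 / 2 ≤ (w 0).re) :
    ‖z - w‖ ≤ 3 * (2 * m + 1) * dist (coordProj z) (coordProj w) := by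
  set D := dist (coordProj z) (coordProj w) with hD
  have hD0 : 0 ≤ D := dist_nonneg
  have hi : ∀ i, |coordProj z i - coordProj w i| ≤ D := fun i => by
    rw [← Real.dist_eq]; exact dist_le_pi_dist _ _ i
  have hcard : ((Finset.univ : Finset (Option (Fin m × Bool))).card : ℝ) = 2 * m + 1 := by
    simp [Fintype.card_option]; ring
  have hz1 := norm_sq_eq_coordProj z
  have hw1 := norm_sq_eq_coordProj w
  rw [norm_of_mem_Sn hz] at hz1
  rw [norm_of_mem_Sn hw] at hw1
  have hbz : ∀ i, |coordProj z i| ≤ 1 := fun i => (abs_coordProj_le z i).trans (norm_of_mem_Sn hz).le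
  have hbw : ∀ i, |coordProj w i| ≤ 1 := fun i => (abs_coordProj_le w i).trans (norm_of_mem_Sn hw).le
  have hre : |(z 0).re - (w 0).re| ≤ (2 * m + 1) * (D * 2) := by
    have e1 : ((z 0).re - (w 0).re) * ((z 0).re + (w 0).re)
        = ∑ i, (coordProj w i - coordProj z i) * (coordProj w i + coordProj z i) := by
      have : ∑ i, (coordProj w i - coordProj z i) * (coordProj w i + coordProj z i)
        = ∑ i, coordProj w i ^ 2 - ∑ i, coordProj z i ^ 2 := by
        rw [← Finset.sum_sub_distrib]; exact Finset.sum_congr rfl fun i _ => by ring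
      rw [this]; linarith
    have e2 : |((z 0).re - (w 0).re) * ((z 0).re + (w 0).re)| ≤ (2 * m + 1) * (D * 2) := by
      rw [e1]
      refine (Finset.abs_sum_le_sum_abs _ _).trans ?_
      refine (Finset.sum_le_card_nsmul _ _ (D * 2) fun i _ => ?_).trans ?_
      · rw [abs_mul, abs_sub_comm]
        refine mul_le_mul (hi i) ((abs_add_le _ _).trans ?_) (abs_nonneg _) hD0
        linarith [hbz i, hbw i]
      · rw [nsmul_eq_mul, hcard]
    rw [abs_mul, abs_of_pos (by linarith : 0 < (z 0).re + (w 0).re)] at e2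
    nlinarith [abs_nonneg ((z 0).re - (w 0).re)]
  have hsum : ∑ i, coordProj (z - w) i ^ 2 ≤ (2 * m + 1) * D ^ 2 := by
    refine (Finset.sum_le_card_nsmul _ _ (D ^ 2) fun i _ => ?_).trans ?_
    · rw [coordProj_sub, Pi.sub_apply]; exact sq_le_sq' (by linarith [neg_le_of_abs_le (hi i)]) (le_of_abs_le (hi i))
    · rw [nsmul_eq_mul, hcard]
  have hm : (0 : ℝ) ≤ m := Nat.cast_nonneg m
  apply le_of_sq_le_sq _ (by positivity)
  rw [norm_sq_eq_coordProj (z - w)]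
  have h3 : ((z - w) 0).re ^ 2 ≤ ((2 * m + 1) * (D * 2)) ^ 2 := by
    rw [← sq_abs]
    exact pow_le_pow_left₀ (abs_nonneg _) (by simpa using hre) 2
  nlinarith [mul_nonneg hm (sq_nonneg D), mul_nonneg (mul_nonneg hm hm) (sq_nonneg D), sq_nonneg D]

end Chart

section BallBounds

variable {m : ℕ}

/-- The first vector of the standard basis. -/
def firstVec (m : ℕ) : En (m + 1) := EuclideanSpace.single 0 1

theorem herm_firstVec (z : En (m + 1)) : herm z (firstVec m) = z 0 := by
  simp [herm_eq_inner, firstVec, EuclideanSpace.inner_single_left]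

theorem dim_eq_card (m : ℕ) :
    (2 * ((m + 1 : ℕ) : ℝ) - 1) = (Fintype.card (Option (Fin m × Bool)) : ℕ) := by
  simp [Fintype.card_option]; ring

theorem hausdorffMeasure_cap_le {A : Set (En (m + 1))}
    (hA : ∀ z ∈ A, z ∈ Sn (m + 1) ∧ 1 / 2 ≤ (z 0).re) :
    μH[2 * ((m + 1 : ℕ) : ℝ) - 1] A ≤
      ENNReal.ofReal (3 * (2 * m + 1)) ^ (2 * ((m + 1 : ℕ) : ℝ) - 1) *
        volume (coordProj '' A) := by
  have hd : (0 : ℝ) ≤ 2 * ((m + 1 : ℕ) : ℝ) - 1 := by rw [dim_eq_card]; positivity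
  have hanti : AntilipschitzWith (Real.toNNReal (3 * (2 * m + 1)))
      (fun z : A => coordProj (z : En (m + 1))) := by
    apply AntilipschitzWith.of_le_mul_dist
    intro z w
    rw [Real.coe_toNNReal _ (by positivity), Subtype.dist_eq, dist_eq_norm]
    exact norm_sub_le_coordProj (hA z z.2).1 (hA w w.2).1 (hA z z.2).2 (hA w w.2).2
  have h1 := hanti.le_hausdorffMeasure_image hd univ
  have h2 := (isometry_subtype_coe (s := A)).hausdorffMeasure_image (Or.inl hd) univ
  rw [image_univ, Subtype.range_coe] at h2
  have h3 : (fun z : A => coordProj (z : En (m + 1))) '' univ = coordProj '' A := by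
    rw [image_univ]; ext y; simp
  rw [h3] at h1
  rw [h2]
  refine h1.trans_eq ?_
  congr 1
  rw [dim_eq_card, hausdorffMeasure_pi_real]

theorem norm_le_of_mem_korBall {t : ℝ} {z : En (m + 1)} (hz : z ∈ korBall (firstVec m) t) :
    1 - t < (z 0).re ∧ |(z 0).im| < t ∧ ∀ k : Fin m, ‖z k.succ‖ ^ 2 < 2 * t := by
  obtain ⟨hS, hd⟩ := hz
  rw [korDist, herm_firstVec] at hd
  have h1 := Complex.abs_re_le_norm (1 - z 0)
  have h2 := Complex.abs_im_le_norm (1 - z 0)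
  simp only [Complex.sub_re, Complex.one_re, Complex.sub_im, Complex.one_im, zero_sub,
    abs_neg] at h1 h2
  have h4 : ‖z 0‖ ≤ 1 := (PiLp.norm_apply_le z 0).trans (norm_of_mem_Sn hS).le
  have h5 : 1 - ‖z 0‖ < t := by
    have := norm_sub_norm_le (1 : ℂ) (z 0)
    rw [norm_one] at this; linarith
  refine ⟨by linarith [le_abs_self (1 - (z 0).re)], by linarith, fun k => ?_⟩
  have h3 := EuclideanSpace.norm_sq_eq z
  rw [norm_of_mem_Sn hS, Fin.sum_univ_succ] at h3
  have := Finset.single_le_sum (f := fun k : Fin m => ‖z k.succ‖ ^ 2) (fun i _ => sq_nonneg _)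
    (Finset.mem_univ k)
  simp only [one_pow] at this h3
  nlinarith [norm_nonneg (z 0)]

theorem volume_chartBox {a b : ℝ} (ha : 0 ≤ a) (hb : 0 ≤ b) :
    volume (Set.pi univ fun i : Option (Fin m × Bool) =>
      Ioo (-(i.elim a fun _ => b)) (i.elim a fun _ => b)) =
      ENNReal.ofReal (2 * a * (4 * b ^ 2) ^ m) := by
  rw [Real.volume_pi_Ioo, Fintype.prod_option]
  simp only [Option.elim_none, Option.elim_some, sub_neg_eq_add, Finset.prod_const,
    Finset.card_univ, Fintype.card_prod, Fintype.card_fin, Fintype.card_bool]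
  rw [← ENNReal.ofReal_pow (by positivity), ← ENNReal.ofReal_mul (by positivity)]
  congr 1
  rw [mul_comm m 2, pow_mul]
  ring

theorem hausdorffMeasure_korBall_le (m : ℕ) : ∃ K : ℝ, 0 < K ∧ ∀ t : ℝ, 0 < t → t ≤ 1 / 2 →
    μH[2 * ((m + 1 : ℕ) : ℝ) - 1] (korBall (firstVec m) t) ≤ ENNReal.ofReal (K * t ^ (m + 1)) := by
  have hd : (0 : ℝ) ≤ 2 * ((m + 1 : ℕ) : ℝ) - 1 := by rw [dim_eq_card]; positivity
  refine ⟨(3 * (2 * m + 1)) ^ (2 * ((m + 1 : ℕ) : ℝ) - 1) * (2 * 8 ^ m), by positivity,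
    fun t ht ht2 => ?_⟩
  refine (hausdorffMeasure_cap_le fun z hz => ⟨hz.1, ?_⟩).trans ?_
  · linarith [(norm_le_of_mem_korBall hz).1]
  have hsub : coordProj '' (korBall (firstVec m) t) ⊆
      Set.pi univ fun i : Option (Fin m × Bool) =>
        Ioo (-(i.elim t fun _ => √(2 * t))) (i.elim t fun _ => √(2 * t)) := by
    rintro _ ⟨z, hz, rfl⟩ i -
    obtain ⟨-, h2, h3⟩ := norm_le_of_mem_korBall hz
    have h4 : ∀ k : Fin m, ‖z k.succ‖ < √(2 * t) := fun k =>
      Real.lt_sqrt_of_sq_lt (h3 k)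
    rw [mem_Ioo, ← abs_lt]
    match i with
    | none => exact h2
    | some (k, true) => exact (Complex.abs_im_le_norm _).trans_lt (h4 k)
    | some (k, false) => exact (Complex.abs_re_le_norm _).trans_lt (h4 k)
  refine (mul_le_mul_right (measure_mono hsub) _).trans ?_
  rw [volume_chartBox ht.le (Real.sqrt_nonneg _), Real.sq_sqrt (by positivity),
    ENNReal.ofReal_rpow_of_nonneg (by positivity) hd, ← ENNReal.ofReal_mul (by positivity)]
  apply ENNReal.ofReal_le_ofReal
  apply le_of_eq
  rw [show 4 * (2 * t) = 8 * t by ring, mul_pow]; ring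

theorem le_hausdorffMeasure_korBall (m : ℕ) : ∃ c : ℝ, 0 < c ∧ ∀ t : ℝ, 0 < t → t ≤ 1 →
    ENNReal.ofReal (c * t ^ (m + 1)) ≤ μH[2 * ((m + 1 : ℕ) : ℝ) - 1] (korBall (firstVec m) t) := by
  have hd : (0 : ℝ) ≤ 2 * ((m + 1 : ℕ) : ℝ) - 1 := by rw [dim_eq_card]; positivity
  set κ : ℝ := 1 / (4 * (m + 1)) with hκ
  have hκ0 : 0 < κ := by positivity
  have hκm : 2 * m * κ ^ 2 ≤ 1 / 8 := by
    have hm : (0 : ℝ) ≤ m := Nat.cast_nonneg m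
    rw [hκ, div_pow, ← mul_div_assoc, div_le_div_iff₀ (by positivity) (by positivity)]
    nlinarith
  refine ⟨1 / 2 * (4 * κ ^ 2) ^ m, by positivity, fun t ht ht1 => ?_⟩
  have h1 := lipschitzWith_coordProj.hausdorffMeasure_image_le hd (korBall (firstVec m) t)
  rw [ENNReal.coe_one, ENNReal.one_rpow, one_mul] at h1
  refine le_trans ?_ h1
  have hsub : (Set.pi univ fun i : Option (Fin m × Bool) =>
        Ioo (-(i.elim (t / 4) fun _ => κ * √t)) (i.elim (t / 4) fun _ => κ * √t)) ⊆
      coordProj '' (korBall (firstVec m) t) := by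
    intro y hy
    have hy' : ∀ i, |y i| < i.elim (t / 4) fun _ => κ * √t := fun i => by
      rw [abs_lt]; exact hy i (mem_univ i)
    have hsq : ∑ i, y i ^ 2 ≤ t / 2 := by
      rw [Fintype.sum_option]
      have hn : y none ^ 2 ≤ (t / 4) ^ 2 := by
        rw [← sq_abs]; exact pow_le_pow_left₀ (abs_nonneg _) (hy' none).le 2
      have hs : ∑ i : Fin m × Bool, y (some i) ^ 2 ≤ 2 * m * κ ^ 2 * t := by
        refine (Finset.sum_le_card_nsmul _ _ ((κ * √t) ^ 2) fun i _ => ?_).trans ?_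
        · rw [← sq_abs]; exact pow_le_pow_left₀ (abs_nonneg _) (hy' (some i)).le 2
        · rw [mul_pow, Real.sq_sqrt ht.le]
          simp
          apply le_of_eq; ring
      nlinarith
    set x0 : ℝ := √(1 - ∑ i, y i ^ 2) with hx0
    have hnn : 0 ≤ 1 - ∑ i, y i ^ 2 := by linarith
    have hx0sq : x0 ^ 2 = 1 - ∑ i, y i ^ 2 := Real.sq_sqrt hnn
    have hx0nn : 0 ≤ x0 := Real.sqrt_nonneg _
    have hS0 : 0 ≤ ∑ i, y i ^ 2 := Finset.sum_nonneg fun i _ => sq_nonneg _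
    have hx01 : x0 ≤ 1 := by nlinarith
    set z : En (m + 1) := WithLp.toLp 2 (Fin.cons (⟨x0, y none⟩ : ℂ)
      (fun k => (⟨y (some (k, false)), y (some (k, true))⟩ : ℂ))) with hz
    have hproj : coordProj z = y := by
      funext i
      match i with
      | none => simp [coordProj, hz]
      | some (k, true) => simp [coordProj, hz]
      | some (k, false) => simp [coordProj, hz]
    have hz0 : z 0 = ⟨x0, y none⟩ := by simp [hz]
    refine ⟨z, ⟨?_, ?_⟩, hproj⟩
    · have h := norm_sq_eq_coordProj z
      rw [hproj, hz0, hx0sq] at h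
      have h' : ‖z‖ ^ 2 = 1 := by linarith
      have : ‖z‖ = 1 := by nlinarith [norm_nonneg z]
      simpa [Sn] using this
    · rw [korDist, herm_firstVec, hz0]
      refine (Complex.norm_le_abs_re_add_abs_im _).trans_lt ?_
      simp only [Complex.sub_re, Complex.one_re, Complex.sub_im, Complex.one_im, zero_sub, abs_neg]
      rw [abs_of_nonneg (by linarith)]
      have := hy' none
      simp only [Option.elim_none] at this
      nlinarith
  rw [dim_eq_card, hausdorffMeasure_pi_real]
  refine le_trans ?_ (measure_mono hsub)
  rw [volume_chartBox (by positivity) (by positivity), mul_pow κ, Real.sq_sqrt ht.le]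
  apply ENNReal.ofReal_le_ofReal
  apply le_of_eq
  rw [← mul_assoc 4, mul_pow]; ring

end BallBounds

section SphereMeasure

theorem exists_linearIsometryEquiv_firstVec {m : ℕ} {ζ : En (m + 1)} (hζ : ζ ∈ Sn (m + 1)) :
    ∃ U : En (m + 1) ≃ₗᵢ[ℂ] En (m + 1), U ζ = firstVec m := by
  have hv : Orthonormal ℂ (({0} : Set (Fin (m + 1))).domRestrict fun _ => ζ) := by
    constructor
    · exact fun i => norm_of_mem_Sn hζ
    · intro i j hij; exact absurd (Subsingleton.elim i j) hij
  obtain ⟨b, hb⟩ := hv.exists_orthonormalBasis_extension_of_card_eq (by simp)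
  refine ⟨b.repr, ?_⟩
  rw [← hb 0 (by simp), b.repr_self]; rfl

theorem herm_map {n : ℕ} (U : En n ≃ₗᵢ[ℂ] En n) (x y : En n) : herm (U x) (U y) = herm x y := by
  simp only [herm_eq_inner, LinearIsometryEquiv.inner_map_map]

theorem preimage_Sn_of_norm {n : ℕ} {U : En n → En n} (hU : ∀ x, ‖U x‖ = ‖x‖) :
    U ⁻¹' Sn n = Sn n := by
  ext x; simp [Sn, hU]

theorem hausdorffMeasure_korBall_eq {m : ℕ} {ζ : En (m + 1)} (hζ : ζ ∈ Sn (m + 1)) (t d : ℝ) :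
    μH[d] (korBall ζ t) = μH[d] (korBall (firstVec m) t) := by
  obtain ⟨U, hU⟩ := exists_linearIsometryEquiv_firstVec hζ
  rw [← U.toIsometryEquiv.hausdorffMeasure_preimage d (korBall (firstVec m) t)]
  congr 1
  ext x
  simp [korBall, korDist, ← hU, herm_map, Sn]

theorem hausdorffMeasure_Sn_lt_top (m : ℕ) :
    μH[2 * ((m + 1 : ℕ) : ℝ) - 1] (Sn (m + 1)) < ⊤ := by
  obtain ⟨K, -, hK⟩ := hausdorffMeasure_korBall_le m
  apply (isCompact_sphere (0 : En (m + 1)) 1).measure_lt_top_of_nhdsWithin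
  intro ζ hζ
  refine ⟨korBall ζ (1 / 2), ?_, ?_⟩
  · have h : {η : En (m + 1) | korDist η ζ < 1 / 2} ∈ 𝓝 ζ := by
      refine (isOpen_lt (by fun_prop) continuous_const).mem_nhds ?_
      have : ‖ζ‖ = 1 := norm_of_mem_Sn hζ
      simp [korDist, herm_self, this]
    exact inter_mem self_mem_nhdsWithin (mem_nhdsWithin_of_mem_nhds h)
  · rw [hausdorffMeasure_korBall_eq hζ]
    exact (hK _ (by norm_num) le_rfl).trans_lt ENNReal.ofReal_lt_top

theorem hausdorffMeasure_Sn_pos (m : ℕ) :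
    0 < μH[2 * ((m + 1 : ℕ) : ℝ) - 1] (Sn (m + 1)) := by
  obtain ⟨c, hc, h⟩ := le_hausdorffMeasure_korBall m
  refine lt_of_lt_of_le ?_ ((h 1 one_pos le_rfl).trans (measure_mono fun z hz => hz.1))
  simpa using hc

theorem sigmaS_apply_of_subset {n : ℕ} {A : Set (En n)} (hA : A ⊆ Sn n) :
    sigmaS n A = (μH[(2 * n - 1 : ℝ)] (Sn n))⁻¹ * μH[(2 * n - 1 : ℝ)] A := by
  rw [sigmaS, Measure.smul_apply, smul_eq_mul, Measure.restrict_eq_self _ hA]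

theorem isProbabilityMeasure_sigmaS {n : ℕ} (hn : 1 ≤ n) : IsProbabilityMeasure (sigmaS n) := by
  obtain ⟨m, rfl⟩ : ∃ m, n = m + 1 := ⟨n - 1, by omega⟩
  constructor
  rw [sigmaS, Measure.smul_apply, smul_eq_mul, Measure.restrict_apply_univ]
  exact ENNReal.inv_mul_cancel (hausdorffMeasure_Sn_pos m).ne' (hausdorffMeasure_Sn_lt_top m).ne

theorem ae_mem_Sn (n : ℕ) : ∀ᵐ ζ ∂sigmaS n, ζ ∈ Sn n := by
  apply Measure.ae_smul_measure
  exact ae_restrict_mem (measurableSet_Sn n)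

theorem measurePreserving_sigmaS {n : ℕ} (e : En n ≃ᵢ En n) (he : ∀ x, ‖e x‖ = ‖x‖) :
    MeasurePreserving e (sigmaS n) (sigmaS n) := by
  have h := (e.measurePreserving_hausdorffMeasure (2 * n - 1 : ℝ)).restrict_preimage
    (measurableSet_Sn n)
  rw [preimage_Sn_of_norm he] at h
  exact h.smul_measure _

theorem measurePreserving_sigmaS_smul {n : ℕ} {c : ℂ} (hc : ‖c‖ = 1) :
    MeasurePreserving (fun x : En n => c • x) (sigmaS n) (sigmaS n) := by
  have hc0 : c ≠ 0 := by rintro rfl; simp at hc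
  let e : En n ≃ᵢ En n := IsometryEquiv.mk' (fun x => c • x) (fun x => c⁻¹ • x)
    (fun x => smul_inv_smul₀ hc0 x)
    (Isometry.of_dist_eq fun x y => by rw [dist_smul₀, hc, one_mul])
  exact measurePreserving_sigmaS e fun x => by
    change ‖c • x‖ = _
    rw [norm_smul, hc, one_mul]

theorem sigmaS_korBall_le {n : ℕ} (hn : 1 ≤ n) : ∃ K : ℝ, 0 < K ∧ ∀ ζ ∈ Sn n, ∀ t : ℝ, 0 < t →
    sigmaS n (korBall ζ t) ≤ ENNReal.ofReal (K * t ^ n) := by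
  have := isProbabilityMeasure_sigmaS hn
  obtain ⟨m, rfl⟩ : ∃ m, n = m + 1 := ⟨n - 1, by omega⟩
  obtain ⟨K, hK, h⟩ := hausdorffMeasure_korBall_le m
  set H := μH[2 * ((m + 1 : ℕ) : ℝ) - 1] (Sn (m + 1)) with hH
  have hHtop : H⁻¹ ≠ ⊤ := ENNReal.inv_ne_top.2 (hausdorffMeasure_Sn_pos m).ne'
  refine ⟨max (H⁻¹.toReal * K) (2 ^ (m + 1)), by positivity, fun ζ hζ t ht => ?_⟩
  rcases le_total t (1 / 2) with ht2 | ht2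
  · rw [sigmaS_apply_of_subset fun x hx => hx.1, hausdorffMeasure_korBall_eq hζ]
    refine (mul_le_mul_right (h t ht ht2) _).trans ?_
    rw [← hH, ← ENNReal.ofReal_toReal hHtop, ← ENNReal.ofReal_mul ENNReal.toReal_nonneg,
      ← mul_assoc, ENNReal.toReal_ofReal ENNReal.toReal_nonneg]
    apply ENNReal.ofReal_le_ofReal
    gcongr
    exact le_max_left _ _
  · refine prob_le_one.trans ?_
    rw [ENNReal.one_le_ofReal]
    calc (1 : ℝ) ≤ (2 * t) ^ (m + 1) := one_le_pow₀ (by linarith)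
      _ = 2 ^ (m + 1) * t ^ (m + 1) := mul_pow _ _ _
      _ ≤ _ := by gcongr; exact le_max_right _ _

theorem le_sigmaS_korBall {n : ℕ} (hn : 1 ≤ n) : ∃ c : ℝ, 0 < c ∧ ∀ ζ ∈ Sn n, ∀ t : ℝ, 0 < t →
    t ≤ 1 → ENNReal.ofReal (c * t ^ n) ≤ sigmaS n (korBall ζ t) := by
  obtain ⟨m, rfl⟩ : ∃ m, n = m + 1 := ⟨n - 1, by omega⟩
  obtain ⟨c, hc, h⟩ := le_hausdorffMeasure_korBall m
  set H := μH[2 * ((m + 1 : ℕ) : ℝ) - 1] (Sn (m + 1)) with hH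
  have hHtop : H⁻¹ ≠ ⊤ := ENNReal.inv_ne_top.2 (hausdorffMeasure_Sn_pos m).ne'
  have hH0 : 0 < H⁻¹.toReal := ENNReal.toReal_pos
    (ENNReal.inv_ne_zero.2 (hausdorffMeasure_Sn_lt_top m).ne) hHtop
  refine ⟨H⁻¹.toReal * c, by positivity, fun ζ hζ t ht ht1 => ?_⟩
  rw [sigmaS_apply_of_subset fun x hx => hx.1, hausdorffMeasure_korBall_eq hζ, mul_assoc,
    ENNReal.ofReal_mul ENNReal.toReal_nonneg, ENNReal.ofReal_toReal hHtop]
  exact mul_le_mul_right (h t ht ht1) _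

end SphereMeasure

theorem setLIntegral_rpow_neg_le_of_geometric {X : Type*} [MeasurableSpace X] {m : Measure X}
    {d : X → ℝ} (hd : Measurable d) (hd0 : ∀ x, 0 ≤ d x) {A α β t b : ℝ} (hA : 0 ≤ A)
    (hβ : 0 < β) (ht : 0 < t) (hb : 0 < b) (hb1 : b ^ (α - β) < 1)
    (hm : ∀ s > 0, m {x | d x < s} ≤ ENNReal.ofReal (A * s ^ α)) {E : Set X}
    (hE : MeasurableSet E)
    (hgeo : ∀ x ∈ E, 0 < d x → ∃ k : ℕ, t * b ^ k / 2 ≤ d x ∧ d x < 2 * (t * b ^ k)) :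
    ∫⁻ x in E, ENNReal.ofReal (d x ^ (-β)) ∂m ≤
      ENNReal.ofReal (A * 2 ^ (α + β) * t ^ (α - β) * (1 - b ^ (α - β))⁻¹) := by
  have hbpos : 0 ≤ b ^ (α - β) := by positivity
  have hpt : ∀ x ∈ E, ENNReal.ofReal (d x ^ (-β)) ≤
      ∑' k : ℕ, {x | d x < 2 * (t * b ^ k)}.indicator
        (fun _ => ENNReal.ofReal ((t * b ^ k / 2) ^ (-β))) x := by
    intro x hx
    rcases (hd0 x).eq_or_lt with h0 | h0
    · rw [← h0, Real.zero_rpow (by linarith)]; simp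
    obtain ⟨k, hk1, hk2⟩ := hgeo x hx h0
    refine le_trans ?_ (ENNReal.le_tsum k)
    rw [indicator_of_mem (by exact hk2)]
    exact ENNReal.ofReal_le_ofReal
      (Real.rpow_le_rpow_of_nonpos (by positivity) hk1 (by linarith))
  have hmeas : ∀ k : ℕ, MeasurableSet {x | d x < 2 * (t * b ^ k)} := fun k =>
    measurableSet_lt hd measurable_const
  calc ∫⁻ x in E, ENNReal.ofReal (d x ^ (-β)) ∂m
      ≤ ∫⁻ x in E, ∑' k : ℕ, {x | d x < 2 * (t * b ^ k)}.indicator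
        (fun _ => ENNReal.ofReal ((t * b ^ k / 2) ^ (-β))) x ∂m := setLIntegral_mono' hE hpt
    _ ≤ ∫⁻ x, ∑' k : ℕ, {x | d x < 2 * (t * b ^ k)}.indicator
        (fun _ => ENNReal.ofReal ((t * b ^ k / 2) ^ (-β))) x ∂m := setLIntegral_le_lintegral _ _
    _ = ∑' k : ℕ, ENNReal.ofReal ((t * b ^ k / 2) ^ (-β)) * m {x | d x < 2 * (t * b ^ k)} := by
        rw [lintegral_tsum fun k => (measurable_const.indicator (hmeas k)).aemeasurable]
        congr 1; funext k
        rw [lintegral_indicator_const (hmeas k)]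
    _ ≤ ∑' k : ℕ, ENNReal.ofReal (A * 2 ^ (α + β) * t ^ (α - β) * (b ^ (α - β)) ^ k) := by
        refine ENNReal.tsum_le_tsum fun k => ?_
        refine (mul_le_mul_right (hm _ (by positivity)) _).trans_eq ?_
        rw [← ENNReal.ofReal_mul (by positivity)]
        congr 1
        have hk : 0 < t * b ^ k := by positivity
        have e1 : (t * b ^ k / 2) ^ (-β) = (t * b ^ k) ^ (-β) * 2 ^ β := by
          rw [Real.div_rpow hk.le (by norm_num), Real.rpow_neg (by norm_num : (0:ℝ) ≤ 2),
            div_inv_eq_mul]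
        have e2 : t ^ (α - β) * (b ^ (α - β)) ^ k = (t * b ^ k) ^ α * (t * b ^ k) ^ (-β) := by
          rw [← Real.rpow_add hk, ← sub_eq_add_neg, Real.mul_rpow ht.le (by positivity),
            ← Real.rpow_natCast, ← Real.rpow_natCast, ← Real.rpow_mul hb.le, ← Real.rpow_mul hb.le,
            mul_comm (α - β)]
        rw [e1, Real.mul_rpow (by norm_num) hk.le, mul_assoc (A * 2 ^ (α + β)), e2,
          Real.rpow_add (by norm_num)]
        ring
    _ = ENNReal.ofReal (∑' k : ℕ, A * 2 ^ (α + β) * t ^ (α - β) * (b ^ (α - β)) ^ k) :=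
        (ENNReal.ofReal_tsum_of_nonneg (fun k => by positivity)
          ((summable_geometric_of_lt_one hbpos hb1).mul_left _)).symm
    _ = _ := by rw [tsum_mul_left, tsum_geometric_of_lt_one hbpos hb1]

theorem setLIntegral_rpow_neg_near_le {X : Type*} [MeasurableSpace X] {m : Measure X}
    {d : X → ℝ} (hd : Measurable d) (hd0 : ∀ x, 0 ≤ d x) {A α β t : ℝ} (hA : 0 ≤ A)
    (hβ : 0 < β) (hαβ : β < α) (ht : 0 < t)
    (hm : ∀ s > 0, m {x | d x < s} ≤ ENNReal.ofReal (A * s ^ α)) :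
    ∫⁻ x in {x | d x < t}, ENNReal.ofReal (d x ^ (-β)) ∂m ≤
      ENNReal.ofReal (A * 2 ^ (α + β) * t ^ (α - β) * (1 - (1 / 2) ^ (α - β))⁻¹) := by
  refine setLIntegral_rpow_neg_le_of_geometric hd hd0 hA hβ ht (by norm_num)
    (Real.rpow_lt_one (by norm_num) (by norm_num) (by linarith)) hm
    (measurableSet_lt hd measurable_const) fun x hx hx0 => ?_
  have hx' : d x < t := hx
  obtain ⟨k, hk1, hk2⟩ := exists_nat_pow_near_of_lt_one (div_pos hx0 ht)
    ((div_le_one ht).2 hx'.le) (by norm_num : (0 : ℝ) < 1 / 2) (by norm_num)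
  rw [lt_div_iff₀ ht, pow_succ] at hk1
  rw [div_le_iff₀ ht] at hk2
  exact ⟨k, by linarith, by nlinarith [mul_pos ht (pow_pos (by norm_num : (0 : ℝ) < 1 / 2) k)]⟩

theorem setLIntegral_rpow_neg_far_le {X : Type*} [MeasurableSpace X] {m : Measure X}
    {d : X → ℝ} (hd : Measurable d) (hd0 : ∀ x, 0 ≤ d x) {A α β t : ℝ} (hA : 0 ≤ A)
    (hβ : 0 < β) (hαβ : α < β) (ht : 0 < t)
    (hm : ∀ s > 0, m {x | d x < s} ≤ ENNReal.ofReal (A * s ^ α)) :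
    ∫⁻ x in {x | t ≤ d x}, ENNReal.ofReal (d x ^ (-β)) ∂m ≤
      ENNReal.ofReal (A * 2 ^ (α + β) * t ^ (α - β) * (1 - 2 ^ (α - β))⁻¹) := by
  refine setLIntegral_rpow_neg_le_of_geometric hd hd0 hA hβ ht (by norm_num)
    (Real.rpow_lt_one_of_one_lt_of_neg (by norm_num) (by linarith)) hm
    (measurableSet_le measurable_const hd) fun x hx hx0 => ?_
  have hx' : t ≤ d x := hx
  obtain ⟨k, hk1, hk2⟩ := exists_nat_pow_near ((one_le_div ht).2 hx')
    (by norm_num : (1 : ℝ) < 2)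
  rw [le_div_iff₀ ht] at hk1
  rw [div_lt_iff₀ ht, pow_succ] at hk2
  exact ⟨k, by nlinarith [mul_pos ht (pow_pos (by norm_num : (0 : ℝ) < 2) k)], by linarith⟩

theorem korDist_le_two_mul {n : ℕ} {ζ x : En n} (hζ : ζ ∈ Sn n) (hx : ‖x‖ ≤ 1) {ρ : ℝ}
    (h0 : 0 ≤ ρ) (h1 : ρ < 1) : korDist x ζ ≤ 2 * korDist x ((ρ : ℂ) • ζ) := by
  have hζ1 := norm_of_mem_Sn hζ
  have h2 := one_sub_norm_le_korDist (z := (ρ : ℂ) • ζ) (ζ := x) hx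
  rw [korDist_comm, norm_smul, hζ1, mul_one, Complex.norm_real, Real.norm_of_nonneg h0] at h2
  have h3 : (1 : ℂ) - herm x ζ = (1 - herm x ((ρ : ℂ) • ζ)) - (1 - ρ : ℝ) * herm x ζ := by
    rw [herm_smul_right]; simp; ring
  have h4 : ‖((1 - ρ : ℝ) : ℂ) * herm x ζ‖ ≤ 1 - ρ := by
    rw [norm_mul, Complex.norm_real, Real.norm_of_nonneg (by linarith)]
    refine mul_le_of_le_one_right (by linarith) ((norm_herm_le _ _).trans ?_)
    rw [hζ1, mul_one]; exact hx
  have h5 : korDist x ζ ≤ korDist x ((ρ : ℂ) • ζ) + (1 - ρ) := by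
    unfold korDist
    rw [h3]
    exact (norm_sub_le _ _).trans (by gcongr)
  linarith

theorem exists_smul_mem_Sn {n : ℕ} (hn : 1 ≤ n) (z : En n) :
    ∃ e ∈ Sn n, z = ((‖z‖ : ℝ) : ℂ) • e := by
  rcases eq_or_ne z 0 with rfl | hz
  · exact ⟨EuclideanSpace.single ⟨0, hn⟩ 1, by simp [Sn], by simp⟩
  · have hz' : (‖z‖ : ℂ) ≠ 0 := by simpa using hz
    refine ⟨((‖z‖ : ℝ) : ℂ)⁻¹ • z, ?_, (smul_inv_smul₀ hz' z).symm⟩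
    simp [Sn, norm_smul, hz]

theorem lintegral_korDist_rpow_le {n : ℕ} (hn : 1 ≤ n) {M : ℝ} (hM : (n : ℝ) < M) :
    ∃ C : ℝ, 0 < C ∧ ∀ z ∈ Bn n,
      ∫⁻ ζ, ENNReal.ofReal (korDist ζ z ^ (-M)) ∂sigmaS n ≤
        ENNReal.ofReal (C * (1 - ‖z‖) ^ ((n : ℝ) - M)) := by
  obtain ⟨K, hK, hball⟩ := sigmaS_korBall_le hn
  have h2 : (2 : ℝ) ^ ((n : ℝ) - M) < 1 :=
    Real.rpow_lt_one_of_one_lt_of_neg (by norm_num) (by linarith)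
  have h2' : 0 < (1 - (2 : ℝ) ^ ((n : ℝ) - M))⁻¹ := inv_pos.2 (by linarith)
  refine ⟨K * 2 ^ n * 2 ^ ((n : ℝ) + M) * (1 - 2 ^ ((n : ℝ) - M))⁻¹, by positivity,
    fun z hz => ?_⟩
  have hz1 : ‖z‖ < 1 := mem_Bn.1 hz
  obtain ⟨e, he, hze⟩ := exists_smul_mem_Sn hn z
  have hMpos : 0 < M := lt_of_le_of_lt (Nat.cast_nonneg n) hM
  have hm : ∀ s > 0, sigmaS n {x | korDist x z < s} ≤
      ENNReal.ofReal (K * 2 ^ n * s ^ (n : ℝ)) := by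
    intro s hs
    have hle : sigmaS n {x | korDist x z < s} ≤ sigmaS n (korBall e (2 * s)) := by
      apply measure_mono_ae
      filter_upwards [ae_mem_Sn n] with x hx hxs
      have hxs' : korDist x z < s := hxs
      refine ⟨hx, ?_⟩
      have := korDist_le_two_mul he (norm_of_mem_Sn hx).le (norm_nonneg z) hz1
      rw [← hze] at this
      linarith
    refine hle.trans ((hball e he _ (by positivity)).trans_eq ?_)
    rw [mul_pow, Real.rpow_natCast, mul_assoc]
  have h := setLIntegral_rpow_neg_far_le (m := sigmaS n) (d := fun ζ => korDist ζ z)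
    (Continuous.measurable (by fun_prop)) (fun x => korDist_nonneg _ _) (by positivity) hMpos hM
    (sub_pos.2 hz1) hm
  have hall : ∀ᵐ x ∂sigmaS n, x ∈ {x | 1 - ‖z‖ ≤ korDist x z} := by
    filter_upwards [ae_mem_Sn n] with x hx
    have := one_sub_norm_le_korDist (z := z) (norm_of_mem_Sn hx).le
    rwa [korDist_comm] at this
  rw [Measure.restrict_eq_self_of_ae_mem hall] at h
  refine h.trans_eq ?_
  congr 1; ring

section BallAutomorphism

variable {n : ℕ}

/-- The automorphism of the unit ball sending `0` to `ρ • e`, for a unit vector `e`. -/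
def ballAut (e : En n) (ρ : ℝ) (w : En n) : En n :=
  ((1 : ℂ) - ρ * herm w e)⁻¹ •
    (((ρ : ℂ) - herm w e) • e - ((√(1 - ρ ^ 2) : ℝ) : ℂ) • (w - herm w e • e))

theorem ballAut_zero (e : En n) (ρ : ℝ) : ballAut e ρ 0 = (ρ : ℂ) • e := by
  have h : herm (0 : En n) e = 0 := by simp [herm]
  simp [ballAut, h]

theorem norm_one_sub_mul_herm_ge {e w : En n} (he : e ∈ Sn n) (hw : ‖w‖ ≤ 1) {ρ : ℝ}
    (h0 : 0 ≤ ρ) : 1 - ρ ≤ ‖(1 : ℂ) - ρ * herm w e‖ := by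
  have h1 := norm_sub_norm_le (1 : ℂ) (ρ * herm w e)
  have h2 := norm_herm_le w e
  rw [norm_of_mem_Sn he, mul_one] at h2
  rw [norm_one, norm_mul, Complex.norm_real, Real.norm_of_nonneg h0] at h1
  nlinarith

theorem norm_one_sub_mul_herm_le {e w : En n} (he : e ∈ Sn n) (hw : ‖w‖ ≤ 1) {ρ : ℝ}
    (h0 : 0 ≤ ρ) (h1 : ρ < 1) : ‖(1 : ℂ) - ρ * herm w e‖ ≤ 2 := by
  have h2 := norm_sub_le (1 : ℂ) (ρ * herm w e)
  have h3 := norm_herm_le w e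
  rw [norm_of_mem_Sn he, mul_one] at h3
  rw [norm_one, norm_mul, Complex.norm_real, Real.norm_of_nonneg h0] at h2
  nlinarith [norm_nonneg (herm w e)]

theorem norm_ballAut_sq {e w : En n} (he : e ∈ Sn n) {ρ : ℝ} (h0 : 0 ≤ ρ) (h1 : ρ < 1)
    (hd : (1 : ℂ) - ρ * herm w e ≠ 0) :
    ‖ballAut e ρ w‖ ^ 2 * ‖(1 : ℂ) - ρ * herm w e‖ ^ 2 =
      ‖(1 : ℂ) - ρ * herm w e‖ ^ 2 - (1 - ρ ^ 2) * (1 - ‖w‖ ^ 2) := by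
  have hee : herm e e = 1 := by rw [herm_self, norm_of_mem_Sn he]; simp
  have hs : (((√(1 - ρ ^ 2) : ℝ) : ℂ)) ^ 2 = 1 - ρ ^ 2 := by
    rw [← Complex.ofReal_pow, Real.sq_sqrt (by nlinarith)]; simp
  have hww := herm_self w
  set s : ℝ := √(1 - ρ ^ 2) with hsdef
  set v : En n := ((ρ : ℂ) - herm w e) • e - (s : ℂ) • (w - herm w e • e) with hv
  have hnv : ((‖v‖ ^ 2 : ℝ) : ℂ) = ((‖(1 : ℂ) - ρ * herm w e‖ ^ 2 -
      (1 - ρ ^ 2) * (1 - ‖w‖ ^ 2) : ℝ) : ℂ) := by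
    push_cast
    rw [← herm_self v, ← Complex.mul_conj', hv]
    simp only [herm_sub_left, herm_sub_right, herm_smul_left, herm_smul_right, hee, map_sub,
      map_mul, Complex.conj_ofReal, conj_herm, hww, map_one]
    linear_combination ((‖w‖ : ℂ) ^ 2 - herm w e * herm e w) * hs
  have hnv' := Complex.ofReal_injective hnv
  have hb : ballAut e ρ w = ((1 : ℂ) - ρ * herm w e)⁻¹ • v := rfl
  rw [← hnv', hb, norm_smul, norm_inv, mul_pow]
  have : ‖(1 : ℂ) - ρ * herm w e‖ ≠ 0 := norm_ne_zero_iff.2 hd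
  field_simp

theorem ballAut_denom_ne_zero {e w : En n} (he : e ∈ Sn n) (hw : ‖w‖ ≤ 1) {ρ : ℝ}
    (h0 : 0 ≤ ρ) (h1 : ρ < 1) : (1 : ℂ) - ρ * herm w e ≠ 0 := by
  rw [← norm_pos_iff]
  linarith [norm_one_sub_mul_herm_ge he hw h0]

theorem norm_ballAut_le_one {e w : En n} (he : e ∈ Sn n) (hw : ‖w‖ ≤ 1) {ρ : ℝ}
    (h0 : 0 ≤ ρ) (h1 : ρ < 1) : ‖ballAut e ρ w‖ ≤ 1 := by
  have hd := ballAut_denom_ne_zero he hw h0 h1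
  have h := norm_ballAut_sq he h0 h1 hd
  have h2 : 0 < ‖(1 : ℂ) - ρ * herm w e‖ ^ 2 := by positivity
  have h3 : 0 ≤ (1 - ρ ^ 2) * (1 - ‖w‖ ^ 2) := by
    apply mul_nonneg <;> nlinarith [norm_nonneg w]
  by_contra! hlt
  nlinarith [mul_lt_mul_of_pos_right (show 1 < ‖ballAut e ρ w‖ ^ 2 by nlinarith) h2]

theorem ballAut_mem_Sn {e w : En n} (he : e ∈ Sn n) (hw : w ∈ Sn n) {ρ : ℝ}
    (h0 : 0 ≤ ρ) (h1 : ρ < 1) : ballAut e ρ w ∈ Sn n := by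
  have hd := ballAut_denom_ne_zero he (norm_of_mem_Sn hw).le h0 h1
  have h := norm_ballAut_sq he h0 h1 hd
  rw [norm_of_mem_Sn hw, one_pow, sub_self, mul_zero, sub_zero] at h
  have h2 : ‖(1 : ℂ) - ρ * herm w e‖ ^ 2 ≠ 0 := by simpa using hd
  have h3 : ‖ballAut e ρ w‖ ^ 2 = 1 := mul_right_cancel₀ h2 (by rw [h, one_mul])
  have : ‖ballAut e ρ w‖ = 1 := by nlinarith [norm_nonneg (ballAut e ρ w)]
  simpa [Sn] using this

theorem one_sub_herm_ballAut {e x : En n} (y : En n) (he : e ∈ Sn n) (hx : ‖x‖ ≤ 1) {ρ : ℝ}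
    (h0 : 0 ≤ ρ) (h1 : ρ < 1) :
    ((1 : ℂ) - ρ * herm x e) * (1 - herm (ballAut e ρ x) y) =
      1 - ρ * herm x e - ρ * herm e y + herm x e * herm e y +
        (√(1 - ρ ^ 2) : ℝ) * (herm x y - herm x e * herm e y) := by
  have hd := ballAut_denom_ne_zero he hx h0 h1
  rw [ballAut]
  simp only [herm_sub_left, herm_smul_left]
  field_simp
  ring

theorem korDist_ballAut_le {e x y : En n} (he : e ∈ Sn n) (hx : ‖x‖ ≤ 1) (hy : ‖y‖ ≤ 1) {ρ : ℝ}
    (h0 : 0 ≤ ρ) (h1 : ρ < 1) :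
    korDist x (ballAut e ρ y) ≤ 2 / (1 - ρ) * korDist (ballAut e ρ x) y := by
  have e1 := one_sub_herm_ballAut y he hx h0 h1
  have e2 := one_sub_herm_ballAut x he hy h0 h1
  have e3 := congrArg (starRingEnd ℂ) e2
  simp only [map_mul, map_add, map_sub, map_one, Complex.conj_ofReal, conj_herm] at e3
  have e4 : ‖(1 : ℂ) - ρ * herm y e‖ * korDist x (ballAut e ρ y) =
      ‖(1 : ℂ) - ρ * herm x e‖ * korDist (ballAut e ρ x) y := by
    rw [korDist, korDist, ← norm_mul, ← norm_mul, e1]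
    have : ‖(1 - (ρ : ℂ) * herm y e) * (1 - herm x (ballAut e ρ y))‖ =
        ‖(1 - (ρ : ℂ) * herm e y) * (1 - herm x (ballAut e ρ y))‖ := by
      rw [norm_mul, norm_mul]
      congr 1
      rw [← RCLike.norm_conj]
      simp [conj_herm]
    rw [this, e3]
    congr 1; ring
  have h2 := norm_one_sub_mul_herm_ge he hy h0
  have h3 := norm_one_sub_mul_herm_le he hx h0 h1
  rw [div_mul_eq_mul_div, le_div_iff₀ (by linarith)]
  nlinarith [korDist_nonneg x (ballAut e ρ y), korDist_nonneg (ballAut e ρ x) y]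

theorem measurable_ballAut (e : En n) (ρ : ℝ) : Measurable (ballAut e ρ) := by
  unfold ballAut
  apply Measurable.fun_smul
  · exact (Continuous.measurable (by fun_prop)).inv
  · exact Continuous.measurable (by fun_prop)

theorem measurable_korDist_comp {X : Type*} [MeasurableSpace X] {f g : X → En n}
    (hf : Measurable f) (hg : Measurable g) : Measurable fun x => korDist (f x) (g x) := by
  have hk : Measurable fun p : En n × En n => (1 : ℂ) - herm p.1 p.2 :=
    Continuous.measurable (by fun_prop)
  exact (hk.comp (hf.prodMk hg)).norm

theorem exists_korDist_uniform {v : En n → ℝ} (hv : ContinuousOn v (Sn n)) {ε : ℝ} (hε : 0 < ε) :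
    ∃ t, 0 < t ∧ t ≤ 1 ∧ ∀ x ∈ Sn n, ∀ y ∈ Sn n, korDist y x < t → v x ≤ v y + ε := by
  have hu := (isCompact_sphere (0 : En n) 1).uniformContinuousOn_of_continuous hv
  obtain ⟨η, hη, h⟩ := Metric.uniformContinuousOn_iff.1 hu ε hε
  refine ⟨min 1 (η ^ 2 / 2), by positivity, min_le_left _ _, fun x hx y hy hxy => ?_⟩
  have h1 := norm_sub_sq_le_korDist hy hx
  have h2 : korDist y x < η ^ 2 / 2 := hxy.trans_le (min_le_right _ _)
  have h3 : dist y x < η := by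
    rw [dist_eq_norm]
    exact lt_of_pow_lt_pow_left₀ 2 hη.le (by linarith)
  have h4 := h y hy x hx h3
  rw [Real.dist_eq] at h4
  linarith [neg_le_abs (v y - v x)]

theorem lintegral_comp_ballAut_le (hn : 1 ≤ n) : ∃ C : ℝ, 0 < C ∧ ∀ e ∈ Sn n, ∀ ρ : ℝ, 0 ≤ ρ →
    ρ < 1 → ∀ v : En n → ℝ, Measurable v → ContinuousOn v (Sn n) →
      ∫⁻ x, ENNReal.ofReal (v (ballAut e ρ x)) ∂sigmaS n ≤
        ENNReal.ofReal (C * (1 - ρ)⁻¹ ^ n) * ∫⁻ y, ENNReal.ofReal (v y) ∂sigmaS n := by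
  have := isProbabilityMeasure_sigmaS hn
  obtain ⟨K, hK, hKb⟩ := sigmaS_korBall_le hn
  obtain ⟨c, hc, hcb⟩ := le_sigmaS_korBall hn
  refine ⟨K * 2 ^ n / c, by positivity, fun e he ρ h0 h1 v hv hvc => ?_⟩
  have hρ : 0 < 1 - ρ := by linarith
  have key : ∀ ε : ℝ, 0 < ε → ∫⁻ x, ENNReal.ofReal (v (ballAut e ρ x)) ∂sigmaS n ≤
        ENNReal.ofReal (K * 2 ^ n / c * (1 - ρ)⁻¹ ^ n) *
          (∫⁻ y, ENNReal.ofReal (v y) ∂sigmaS n + ENNReal.ofReal ε) := by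
    intro ε hε
    obtain ⟨t, ht, ht1, hvt⟩ := exists_korDist_uniform hvc hε
    let S : Set (En n × En n) := {p | p.2 ∈ Sn n ∧ korDist p.2 (ballAut e ρ p.1) < t}
    have hS : MeasurableSet S := by
      change MeasurableSet ({p : En n × En n | p.2 ∈ Sn n} ∩
        {p | korDist p.2 (ballAut e ρ p.1) < t})
      refine (measurable_snd (measurableSet_Sn n)).inter
        (measurableSet_lt ?_ measurable_const)
      exact measurable_korDist_comp measurable_snd ((measurable_ballAut e ρ).comp measurable_fst)
    let F : En n × En n → ℝ≥0∞ := S.indicator fun p => ENNReal.ofReal (v p.2 + ε)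
    have hF : Measurable F := by
      refine Measurable.indicator ?_ hS
      exact ((hv.comp measurable_snd).add_const ε).ennreal_ofReal
    have hc0 : ENNReal.ofReal (c * t ^ n) ≠ 0 := by
      rw [Ne, ENNReal.ofReal_eq_zero, not_le]; positivity
    have hlow : ENNReal.ofReal (c * t ^ n) * ∫⁻ x, ENNReal.ofReal (v (ballAut e ρ x)) ∂sigmaS n ≤
        ∫⁻ x, ∫⁻ y, F (x, y) ∂sigmaS n ∂sigmaS n := by
      rw [← lintegral_const_mul' _ _ ENNReal.ofReal_ne_top]
      apply lintegral_mono_ae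
      filter_upwards [ae_mem_Sn n] with x hx
      have hax := ballAut_mem_Sn he hx h0 h1
      calc ENNReal.ofReal (c * t ^ n) * ENNReal.ofReal (v (ballAut e ρ x))
          ≤ ENNReal.ofReal (v (ballAut e ρ x)) * sigmaS n (korBall (ballAut e ρ x) t) := by
            rw [mul_comm]; exact mul_le_mul_right (hcb _ hax t ht ht1) _
        _ = ∫⁻ y, (korBall (ballAut e ρ x) t).indicator
              (fun _ => ENNReal.ofReal (v (ballAut e ρ x))) y ∂sigmaS n := by
            rw [lintegral_indicator_const (measurableSet_korBall _ _)]
        _ ≤ _ := by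
            apply lintegral_mono
            intro y
            by_cases hy : y ∈ korBall (ballAut e ρ x) t
            · have hy' : (x, y) ∈ S := ⟨hy.1, hy.2⟩
              simp only [F, indicator_of_mem hy, indicator_of_mem hy']
              exact ENNReal.ofReal_le_ofReal (hvt _ hax _ hy.1 hy.2)
            · simp [indicator_of_notMem hy]
    have hup : ∫⁻ y, ∫⁻ x, F (x, y) ∂sigmaS n ∂sigmaS n ≤
        ENNReal.ofReal (K * (2 / (1 - ρ) * t) ^ n) *
          (∫⁻ y, ENNReal.ofReal (v y) ∂sigmaS n + ENNReal.ofReal ε) := by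
      have hint : ENNReal.ofReal (K * (2 / (1 - ρ) * t) ^ n) *
          (∫⁻ y, ENNReal.ofReal (v y) ∂sigmaS n + ENNReal.ofReal ε) =
          ∫⁻ y, ENNReal.ofReal (K * (2 / (1 - ρ) * t) ^ n) *
            (ENNReal.ofReal (v y) + ENNReal.ofReal ε) ∂sigmaS n := by
        rw [lintegral_const_mul' _ _ ENNReal.ofReal_ne_top, lintegral_add_right _ measurable_const,
          lintegral_const, measure_univ, mul_one]
      rw [hint]
      apply lintegral_mono_ae
      filter_upwards [ae_mem_Sn n] with y hy
      have hay := ballAut_mem_Sn he hy h0 h1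
      calc ∫⁻ x, F (x, y) ∂sigmaS n
          ≤ ∫⁻ x, (korBall (ballAut e ρ y) (2 / (1 - ρ) * t)).indicator
              (fun _ => ENNReal.ofReal (v y + ε)) x ∂sigmaS n := by
            apply lintegral_mono_ae
            filter_upwards [ae_mem_Sn n] with x hx
            by_cases hxy : (x, y) ∈ S
            · have hlt : korDist (ballAut e ρ x) y < t := by
                rw [korDist_comm]; exact hxy.2
              have hle := korDist_ballAut_le he (norm_of_mem_Sn hx).le (norm_of_mem_Sn hy).le h0 h1
              have hmem : x ∈ korBall (ballAut e ρ y) (2 / (1 - ρ) * t) :=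
                ⟨hx, hle.trans_lt (mul_lt_mul_of_pos_left hlt (by positivity))⟩
              simp only [F, indicator_of_mem hxy, indicator_of_mem hmem, le_refl]
            · simp [F, indicator_of_notMem hxy]
        _ = ENNReal.ofReal (v y + ε) * sigmaS n (korBall (ballAut e ρ y) (2 / (1 - ρ) * t)) := by
            rw [lintegral_indicator_const (measurableSet_korBall _ _)]
        _ ≤ (ENNReal.ofReal (v y) + ENNReal.ofReal ε) *
            ENNReal.ofReal (K * (2 / (1 - ρ) * t) ^ n) :=
            mul_le_mul' ENNReal.ofReal_add_le (hKb _ hay _ (by positivity))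
        _ = _ := mul_comm _ _
    rw [lintegral_lintegral_swap (f := fun y x => F (x, y))
      (hF.comp measurable_swap).aemeasurable] at hup
    have h := hlow.trans hup
    have hsplit : ENNReal.ofReal (K * (2 / (1 - ρ) * t) ^ n) =
        ENNReal.ofReal (c * t ^ n) * ENNReal.ofReal (K * 2 ^ n / c * (1 - ρ)⁻¹ ^ n) := by
      rw [← ENNReal.ofReal_mul (by positivity)]
      congr 1
      rw [mul_pow, div_pow, inv_pow]
      field_simp
    rw [hsplit, mul_assoc] at h
    exact (ENNReal.mul_le_mul_iff_right hc0 ENNReal.ofReal_ne_top).1 h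
  set D := ENNReal.ofReal (K * 2 ^ n / c * (1 - ρ)⁻¹ ^ n) with hD
  set I := ∫⁻ y, ENNReal.ofReal (v y) ∂sigmaS n
  have hlim : Tendsto (fun ε : ℝ => D * (I + ENNReal.ofReal ε)) (𝓝[>] 0)
      (𝓝 (D * (I + ENNReal.ofReal 0))) := by
    apply ENNReal.Tendsto.const_mul _ (Or.inr ENNReal.ofReal_ne_top)
    exact tendsto_const_nhds.add
      ((ENNReal.continuous_ofReal.tendsto 0).mono_left nhdsWithin_le_nhds)
  rw [ENNReal.ofReal_zero, add_zero] at hlim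
  exact ge_of_tendsto hlim (eventually_mem_nhdsWithin.mono fun ε hε => key ε hε)

end BallAutomorphism

section SubMeanValue

theorem rpow_mul_one_add_log_le {a c x : ℝ} (hc : 0 < c) (hx : 0 < x) :
    c ^ a * (1 + a * (Real.log x - Real.log c)) ≤ x ^ a := by
  have h1 : x ^ a = c ^ a * Real.exp (a * (Real.log x - Real.log c)) := by
    rw [Real.rpow_def_of_pos hx, Real.rpow_def_of_pos hc, ← Real.exp_add]
    congr 1; ring
  rw [h1]
  apply mul_le_mul_of_nonneg_left _ (by positivity)
  linarith [Real.add_one_le_exp (a * (Real.log x - Real.log c))]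

theorem log_norm_le_circleAverage {ψ : ℂ → ℂ} (hψ : AnalyticOnNhd ℂ ψ (closedBall 0 1))
    (h0 : ψ 0 ≠ 0) : Real.log ‖ψ 0‖ ≤ Real.circleAverage (fun z => Real.log ‖ψ z‖) 0 1 := by
  have hψ' : AnalyticOnNhd ℂ ψ (closedBall 0 |1|) := by simpa using hψ
  rw [AnalyticOnNhd.circleAverage_log_norm one_ne_zero hψ' h0]
  have : 0 ≤ ∑ᶠ u, (MeromorphicOn.divisor ψ (closedBall 0 |1|) u : ℝ) *
      Real.log (1 * ‖(0 : ℂ) - u‖⁻¹) := by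
    apply finsum_nonneg
    intro u
    by_cases hu : u ∈ closedBall (0 : ℂ) |1|
    · apply mul_nonneg
      · exact_mod_cast MeromorphicOn.AnalyticOnNhd.divisor_nonneg hψ' u
      · rw [one_mul, zero_sub, norm_neg]
        by_cases hu0 : u = 0
        · simp [hu0]
        · apply Real.log_nonneg
          apply (one_le_inv₀ (norm_pos_iff.2 hu0)).2
          simpa using hu
    · rw [Function.locallyFinsuppWithin.apply_eq_zero_of_notMem _ hu]
      simp
  linarith

theorem rpow_norm_le_circleAverage {ψ : ℂ → ℂ} (hψ : AnalyticOnNhd ℂ ψ (closedBall 0 1)) {a : ℝ}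
    (ha : 0 < a) : ‖ψ 0‖ ^ a ≤ Real.circleAverage (fun z => ‖ψ z‖ ^ a) 0 1 := by
  by_cases h0 : ψ 0 = 0
  · rw [h0, norm_zero, Real.zero_rpow ha.ne']
    exact Real.circleAverage_nonneg_of_nonneg fun z _ => by positivity
  have hc : 0 < ‖ψ 0‖ := norm_pos_iff.2 h0
  set c := ‖ψ 0‖
  let g : ℂ → ℝ := fun z => if ψ z = 0 then Real.log c - a⁻¹ else Real.log ‖ψ z‖
  have hcod : (fun z => Real.log ‖ψ z‖) =ᶠ[codiscreteWithin (sphere (0 : ℂ) |1|)] g := by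
    have hcon : IsConnected (closedBall (0 : ℂ) 1) :=
      ⟨⟨0, by simp⟩, (convex_closedBall _ _).isPreconnected⟩
    have h1 := hψ.preimage_zero_mem_codiscreteWithin (x := 0) h0 (by simp) hcon
    have h2 := codiscreteWithin_mono
      (show sphere (0 : ℂ) |1| ⊆ closedBall 0 1 by simpa using sphere_subset_closedBall) h1
    filter_upwards [h2] with z hz
    have : ψ z ≠ 0 := by simpa using hz
    simp [g, this]
  have hlog : CircleIntegrable (fun z => Real.log ‖ψ z‖) 0 1 :=
    MeromorphicOn.circleIntegrable_log_norm fun z hz =>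
      (hψ z (by simpa using sphere_subset_closedBall hz)).meromorphicAt
  have hg : CircleIntegrable g 0 1 := hlog.congr_codiscreteWithin hcod
  have hle : Real.log c ≤ Real.circleAverage g 0 1 := by
    rw [← Real.circleAverage_congr_codiscreteWithin hcod one_ne_zero]
    exact log_norm_le_circleAverage hψ h0
  have hcont : ContinuousOn (fun z => ‖ψ z‖ ^ a) (sphere (0 : ℂ) |1|) := by
    apply ContinuousOn.rpow_const _ fun _ _ => Or.inr ha.le
    apply (hψ.continuousOn.mono _).norm
    simpa using sphere_subset_closedBall
  have hmono : Real.circleAverage (fun z => c ^ a * (1 - a * Real.log c) + (c ^ a * a) • g z) 0 1 ≤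
      Real.circleAverage (fun z => ‖ψ z‖ ^ a) 0 1 := by
    apply Real.circleAverage_mono
    · exact (circleIntegrable_const _ _ _).add (hg.const_smul)
    · exact hcont.circleIntegrable'
    · intro z _
      by_cases hz : ψ z = 0
      · simp only [g, hz, if_true, norm_zero, Real.zero_rpow ha.ne', smul_eq_mul]
        apply le_of_eq
        field_simp
        ring
      · simp only [g, hz, if_false, smul_eq_mul]
        have := rpow_mul_one_add_log_le (a := a) hc (norm_pos_iff.2 hz)
        linarith
  rw [Real.circleAverage_fun_add (f₂ := fun z => (c ^ a * a) • g z)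
    (circleIntegrable_const _ _ _) hg.const_smul, Real.circleAverage_const, Real.circleAverage_fun_smul, smul_eq_mul] at hmono
  have h3 : c ^ a * a * Real.log c ≤ c ^ a * a * Real.circleAverage g 0 1 :=
    mul_le_mul_of_nonneg_left hle (by positivity)
  linarith

theorem rpow_norm_le_lintegral_circleMap {ψ : ℂ → ℂ} (hψ : AnalyticOnNhd ℂ ψ (closedBall 0 1))
    {a : ℝ} (ha : 0 < a) :
    ENNReal.ofReal (2 * Real.pi) * ENNReal.ofReal (‖ψ 0‖ ^ a) ≤
      ∫⁻ θ in Ioc 0 (2 * Real.pi), ENNReal.ofReal (‖ψ (circleMap 0 1 θ)‖ ^ a) := by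
  have h := rpow_norm_le_circleAverage hψ ha
  have hcont : Continuous fun θ : ℝ => ‖ψ (circleMap 0 1 θ)‖ ^ a := by
    apply Continuous.rpow_const _ fun _ => Or.inr ha.le
    apply Continuous.norm
    exact hψ.continuousOn.comp_continuous (continuous_circleMap 0 1)
      fun θ => circleMap_mem_closedBall _ zero_le_one θ
  rw [Real.circleAverage_def, smul_eq_mul, le_inv_mul_iff₀ (by positivity),
    intervalIntegral.integral_of_le (by positivity)] at h
  rw [← ENNReal.ofReal_mul (by positivity), ← ofReal_integral_eq_lintegral_ofReal]
  · exact ENNReal.ofReal_le_ofReal h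
  · exact (hcont.integrableOn_Icc).mono_set Ioc_subset_Icc_self
  · exact ae_of_all _ fun θ => by positivity

end SubMeanValue

section SubMeanValueBall

variable {n : ℕ}

theorem rpow_norm_zero_le_lintegral_sigmaS (hn : 1 ≤ n) {H : En n → ℂ} (hHm : Measurable H)
    (hH : ∀ η ∈ Sn n, AnalyticOnNhd ℂ (fun l : ℂ => H (l • η)) (closedBall 0 1)) {a : ℝ}
    (ha : 0 < a) : ENNReal.ofReal (‖H 0‖ ^ a) ≤ ∫⁻ η, ENNReal.ofReal (‖H η‖ ^ a) ∂sigmaS n := by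
  have := isProbabilityMeasure_sigmaS hn
  have hFm : Measurable fun η => ENNReal.ofReal (‖H η‖ ^ a) :=
    (hHm.norm.pow_const a).ennreal_ofReal
  have hsm : Measurable fun x : En n × ℝ => circleMap 0 1 x.2 • x.1 :=
    Continuous.measurable (((continuous_circleMap 0 1).comp continuous_snd).smul continuous_fst)
  have h1 : ENNReal.ofReal (2 * Real.pi) * ENNReal.ofReal (‖H 0‖ ^ a) ≤
      ∫⁻ η, (∫⁻ θ in Ioc 0 (2 * Real.pi), ENNReal.ofReal (‖H (circleMap 0 1 θ • η)‖ ^ a))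
        ∂sigmaS n := by
    calc _ = ∫⁻ _, ENNReal.ofReal (2 * Real.pi) * ENNReal.ofReal (‖H 0‖ ^ a) ∂sigmaS n := by simp
      _ ≤ _ := by
        apply lintegral_mono_ae
        filter_upwards [ae_mem_Sn n] with η hη
        simpa using rpow_norm_le_lintegral_circleMap (hH η hη) ha
  rw [lintegral_lintegral_swap (f := fun η θ => ENNReal.ofReal (‖H (circleMap 0 1 θ • η)‖ ^ a))
    (hFm.comp hsm).aemeasurable] at h1
  have h2 : ∀ θ : ℝ, ∫⁻ η, ENNReal.ofReal (‖H (circleMap 0 1 θ • η)‖ ^ a) ∂sigmaS n =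
      ∫⁻ η, ENNReal.ofReal (‖H η‖ ^ a) ∂sigmaS n := fun θ =>
    (measurePreserving_sigmaS_smul (n := n) (c := circleMap 0 1 θ)
      (by simp [norm_circleMap_zero])).lintegral_comp hFm
  simp only [h2, lintegral_const, Measure.restrict_apply MeasurableSet.univ, univ_inter,
    Real.volume_Ioc, sub_zero] at h1
  rw [mul_comm (∫⁻ η, ENNReal.ofReal (‖H η‖ ^ a) ∂sigmaS n)] at h1
  exact (ENNReal.mul_le_mul_iff_right (by simp [Real.pi_pos]) ENNReal.ofReal_ne_top).1 h1

theorem differentiableAt_ballAut_smul {e η : En n} {ρ : ℝ} {l : ℂ}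
    (hd : (1 : ℂ) - ρ * herm (l • η) e ≠ 0) :
    DifferentiableAt ℂ (fun l : ℂ => ballAut e ρ (l • η)) l := by
  simp only [ballAut, herm_smul_left] at hd ⊢
  have h1 : DifferentiableAt ℂ (fun l : ℂ => (1 : ℂ) - ρ * (l * herm η e)) l := by fun_prop
  exact (h1.fun_inv hd).fun_smul (by fun_prop)

theorem DifferentiableAt.herm_left {g : ℂ → En n} {l : ℂ} (hg : DifferentiableAt ℂ g l)
    (z : En n) : DifferentiableAt ℂ (fun l => herm (g l) z) l := by
  simp only [herm_eq_inner]
  exact (innerSL ℂ z).differentiableAt.comp l hg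

theorem norm_herm_lt_one {w z : En n} (hw : ‖w‖ ≤ 1) (hz : ‖z‖ < 1) : ‖herm w z‖ < 1 := by
  have h := norm_herm_le w z
  nlinarith [norm_nonneg w, norm_nonneg z]

theorem one_sub_herm_ne_zero {w z : En n} (hw : ‖w‖ ≤ 1) (hz : ‖z‖ < 1) :
    (1 : ℂ) - herm w z ≠ 0 := by
  intro h
  have h1 := norm_herm_lt_one hw hz
  rw [← sub_eq_zero.1 h, norm_one] at h1
  exact lt_irrefl _ h1

/-- The comparison kernel for the invariant Poisson kernel. -/
def ballKer (z ζ : En n) : ℝ := (1 - ‖z‖) ^ n / korDist ζ z ^ (2 * n)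

theorem rpow_norm_le_lintegral_ballKer (hn : 1 ≤ n) {a : ℝ} (ha : 0 < a) :
    ∃ C : ℝ, 0 < C ∧ ∀ F : En n → ℂ, Measurable F → DifferentiableOn ℂ F (Bn n) →
      ∀ r : ℝ, 0 < r → r < 1 → ∀ z ∈ Bn n, ENNReal.ofReal (‖F (r • z)‖ ^ a) ≤
        ENNReal.ofReal C *
          ∫⁻ ζ, ENNReal.ofReal (ballKer z ζ) * ENNReal.ofReal (‖F (r • ζ)‖ ^ a) ∂sigmaS n := by
  obtain ⟨C, hC, hCb⟩ := lintegral_comp_ballAut_le hn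
  obtain ⟨N, hN⟩ := exists_nat_ge (2 * n / a)
  rw [div_le_iff₀ ha] at hN
  refine ⟨C * 2 ^ (N * a), by positivity, fun F hFm hF r hr0 hr1 z hz => ?_⟩
  obtain ⟨e, he, hze⟩ := exists_smul_mem_Sn hn z
  set ρ := ‖z‖ with hρ
  have h0 : 0 ≤ ρ := norm_nonneg _
  have h1 : ρ < 1 := mem_Bn.1 hz
  have hmemB : ∀ w : En n, ‖w‖ ≤ 1 → r • w ∈ Bn n := fun w hw => by
    rw [mem_Bn, norm_smul, Real.norm_of_nonneg hr0.le]
    nlinarith [norm_nonneg w]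
  have hopen : IsOpen (Bn n) := isOpen_ball
  let h : En n → ℂ := fun w => F (r • w) * (((1 - ρ ^ 2 : ℝ) : ℂ) / (1 - herm w z)) ^ N
  have hhm : Measurable h := by
    refine (hFm.comp (measurable_const_smul r)).mul (Measurable.pow_const ?_ N)
    exact measurable_const.div (Continuous.measurable (by fun_prop))
  have hH : ∀ η ∈ Sn n, AnalyticOnNhd ℂ (fun l : ℂ => h (ballAut e ρ (l • η)))
      (closedBall 0 1) := by
    intro η hη l hl
    have hlη : ‖l • η‖ ≤ 1 := by
      rw [norm_smul, norm_of_mem_Sn hη, mul_one]; simpa using hl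
    have hd := ballAut_denom_ne_zero he hlη h0 h1
    have hb := norm_ballAut_le_one he hlη h0 h1
    have hbd := differentiableAt_ballAut_smul hd
    have ev1 : ∀ᶠ l in 𝓝 l, (1 : ℂ) - ρ * herm (l • η) e ≠ 0 := by
      have : Continuous fun l : ℂ => (1 : ℂ) - ρ * herm (l • η) e := by fun_prop
      exact this.continuousAt.eventually_ne hd
    have ev2 : ∀ᶠ l in 𝓝 l, r • ballAut e ρ (l • η) ∈ Bn n :=
      (hbd.continuousAt.const_smul r).eventually_mem (hopen.mem_nhds (hmemB _ hb))
    have ev3 : ∀ᶠ l in 𝓝 l, (1 : ℂ) - herm (ballAut e ρ (l • η)) z ≠ 0 :=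
      (continuousAt_const.sub (hbd.herm_left z).continuousAt).eventually_ne
        (one_sub_herm_ne_zero hb h1)
    rw [Complex.analyticAt_iff_eventually_differentiableAt]
    filter_upwards [ev1, ev2, ev3] with l h1 h2 h3
    have hbd := differentiableAt_ballAut_smul h1
    refine DifferentiableAt.mul ?_ (DifferentiableAt.pow ?_ N)
    · exact (hF.differentiableAt (hopen.mem_nhds h2)).comp l (hbd.const_smul r)
    · exact (differentiableAt_const _).div ((differentiableAt_const _).sub (hbd.herm_left z)) h3
  have hsub := rpow_norm_zero_le_lintegral_sigmaS hn (H := fun w => h (ballAut e ρ w))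
    (hhm.comp (measurable_ballAut e ρ)) hH ha
  have hv := hCb e he ρ h0 h1 (fun w => ‖h w‖ ^ a) (hhm.norm.pow_const a) (by
    apply ContinuousOn.rpow_const _ fun _ _ => Or.inr ha.le
    apply ContinuousOn.norm
    apply ContinuousOn.mul
    · exact hF.continuousOn.comp (continuous_const_smul r).continuousOn
        fun w hw => hmemB w (norm_of_mem_Sn hw).le
    · apply ContinuousOn.pow
      apply ContinuousOn.div continuousOn_const (Continuous.continuousOn (by fun_prop))
      exact fun w hw => one_sub_herm_ne_zero (norm_of_mem_Sn hw).le h1)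
  have hz0 : h (ballAut e ρ 0) = F (r • z) := by
    have hne : ((1 : ℂ) - (ρ : ℂ) ^ 2) ≠ 0 := by
      have : (1 - ρ ^ 2 : ℝ) ≠ 0 := by nlinarith
      exact_mod_cast this
    have : herm z z = (ρ : ℂ) ^ 2 := herm_self z
    simp only [h, ballAut_zero, ← hze, this]
    push_cast
    rw [div_self hne, one_pow, mul_one]
  have hδ : 0 < 1 - ρ := by linarith
  calc ENNReal.ofReal (‖F (r • z)‖ ^ a)
      ≤ ENNReal.ofReal (C * (1 - ρ)⁻¹ ^ n) * ∫⁻ y, ENNReal.ofReal (‖h y‖ ^ a) ∂sigmaS n := by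
        rw [← hz0]; exact hsub.trans hv
    _ = ∫⁻ y, ENNReal.ofReal (C * (1 - ρ)⁻¹ ^ n) * ENNReal.ofReal (‖h y‖ ^ a) ∂sigmaS n :=
        (lintegral_const_mul' _ _ ENNReal.ofReal_ne_top).symm
    _ ≤ ∫⁻ ζ, ENNReal.ofReal (C * 2 ^ (N * a)) *
          (ENNReal.ofReal (ballKer z ζ) * ENNReal.ofReal (‖F (r • ζ)‖ ^ a)) ∂sigmaS n := by
        apply lintegral_mono_ae
        filter_upwards [ae_mem_Sn n] with ζ hζ
        have hk := one_sub_norm_le_korDist (z := z) (norm_of_mem_Sn hζ).le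
        rw [korDist_comm] at hk
        have hk0 : 0 < korDist ζ z := hδ.trans_le hk
        have hle1 : (1 - ρ) / korDist ζ z ≤ 1 := (div_le_one hk0).2 hk
        have hq0 : 0 < (1 - ρ) / korDist ζ z := by positivity
        have hb0 : ballKer z ζ = ((1 - ρ) / korDist ζ z) ^ (2 * n) * (1 - ρ)⁻¹ ^ n := by
          rw [ballKer, ← hρ, div_pow, inv_pow, two_mul, pow_add (1 - ρ)]
          field_simp
        have hq : ‖((1 - ρ ^ 2 : ℝ) : ℂ) / (1 - herm ζ z)‖ ≤ 2 * ((1 - ρ) / korDist ζ z) := by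
          rw [norm_div, Complex.norm_real, Real.norm_of_nonneg (by nlinarith), ← mul_div_assoc]
          exact div_le_div_of_nonneg_right (by nlinarith) hk0.le
        have hpow : (‖((1 - ρ ^ 2 : ℝ) : ℂ) / (1 - herm ζ z)‖ ^ N) ^ a ≤
            2 ^ (N * a) * ((1 - ρ) / korDist ζ z) ^ (2 * n) := by
          rw [← Real.rpow_natCast, ← Real.rpow_mul (norm_nonneg _)]
          calc _ ≤ (2 * ((1 - ρ) / korDist ζ z)) ^ (N * a) :=
                Real.rpow_le_rpow (norm_nonneg _) hq (by positivity)
            _ = 2 ^ (N * a) * ((1 - ρ) / korDist ζ z) ^ (N * a) :=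
                Real.mul_rpow (by norm_num) hq0.le
            _ ≤ _ := by
                apply mul_le_mul_of_nonneg_left _ (by positivity)
                rw [← Real.rpow_natCast _ (2 * n)]
                apply Real.rpow_le_rpow_of_exponent_ge hq0 hle1
                push_cast; exact hN
        have hk : 0 ≤ ballKer z ζ := by rw [hb0]; positivity
        rw [← ENNReal.ofReal_mul (by positivity), ← ENNReal.ofReal_mul hk,
          ← ENNReal.ofReal_mul (by positivity)]
        apply ENNReal.ofReal_le_ofReal
        have hnorm : ‖h ζ‖ ^ a = ‖F (r • ζ)‖ ^ a *
            (‖((1 - ρ ^ 2 : ℝ) : ℂ) / (1 - herm ζ z)‖ ^ N) ^ a := by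
          simp only [h]
          rw [norm_mul, norm_pow, Real.mul_rpow (norm_nonneg _) (by positivity)]
        rw [hnorm, hb0]
        calc _ ≤ C * (1 - ρ)⁻¹ ^ n * (‖F (r • ζ)‖ ^ a *
              (2 ^ (N * a) * ((1 - ρ) / korDist ζ z) ^ (2 * n))) := by gcongr
          _ = _ := by ring
    _ = _ := lintegral_const_mul' _ _ ENNReal.ofReal_ne_top

end SubMeanValueBall

section KernelOperators

variable {X Y : Type*} [MeasurableSpace X] [MeasurableSpace Y]

theorem rpow_le_lintegral_layer {a : ℝ} (ha : 0 < a) (x : ℝ≥0∞) :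
    x ^ a ≤ ENNReal.ofReal a * ∫⁻ t in Ioi (0 : ℝ),
      {t : ℝ | ENNReal.ofReal t < x}.indicator (fun t => ENNReal.ofReal (t ^ (a - 1))) t := by
  have fin : ∀ y : ℝ, 0 ≤ y → ENNReal.ofReal y ^ a ≤ ENNReal.ofReal a * ∫⁻ t in Ioi (0 : ℝ),
      {t : ℝ | ENNReal.ofReal t < ENNReal.ofReal y}.indicator
        (fun t => ENNReal.ofReal (t ^ (a - 1))) t := by
    intro y hy
    have h := lintegral_rpow_eq_lintegral_meas_lt_mul (Measure.dirac ()) (f := fun _ => y)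
      (ae_of_all _ fun _ => hy) aemeasurable_const ha
    rw [lintegral_dirac, ← ENNReal.ofReal_rpow_of_nonneg hy ha.le] at h
    rw [h]
    refine mul_le_mul' le_rfl (setLIntegral_mono' measurableSet_Ioi ?_)
    intro t ht
    by_cases hty : t < y
    · simp [hty, ENNReal.ofReal_lt_ofReal_iff (lt_trans ht hty)]
    · simp [hty]
  by_cases hx : x = ⊤
  · subst hx
    apply le_of_forall_lt
    intro c hc
    rw [ENNReal.top_rpow_of_pos ha] at hc
    have h1 : c ^ (1 / a) ≠ ⊤ := ENNReal.rpow_ne_top_of_nonneg (by positivity) hc.ne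
    have h2 := fin ((c ^ (1 / a)).toReal + 1) (by positivity)
    refine lt_of_lt_of_le ?_ (h2.trans ?_)
    · rw [ENNReal.ofReal_add ENNReal.toReal_nonneg zero_le_one, ENNReal.ofReal_toReal h1]
      calc c = (c ^ (1 / a)) ^ a := by
            rw [← ENNReal.rpow_mul, one_div_mul_cancel ha.ne', ENNReal.rpow_one]
        _ < _ := ENNReal.rpow_lt_rpow (ENNReal.lt_add_right h1 (by simp)) ha
    · gcongr
      exact le_top
  · have h := fin x.toReal ENNReal.toReal_nonneg
    rwa [ENNReal.ofReal_toReal hx] at h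

theorem meas_kernel_lt_le {μ : Measure X} [IsFiniteMeasure μ] {σ : Measure Y} [SFinite σ]
    {k : X → Y → ℝ≥0∞} (hk : Measurable (Function.uncurry k)) {K : ℝ≥0∞} {s : ℝ} (hs : 1 < s)
    (hK : ∀ E, MeasurableSet E → ∀ᵐ y ∂σ, ∫⁻ x in E, k x y ∂μ ≤ K * μ E ^ (1 - 1 / s))
    {u : Y → ℝ≥0∞} (hu : Measurable u) (l : ℝ≥0∞) :
    l ^ s * μ {x | l < ∫⁻ y, k x y * u y ∂σ} ≤ (K * ∫⁻ y, u y ∂σ) ^ s := by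
  have hs0 : 0 < s := by linarith
  have hku : Measurable (Function.uncurry fun x y => k x y * u y) :=
    hk.mul (hu.comp measurable_snd)
  have hT : Measurable fun x => ∫⁻ y, k x y * u y ∂σ := hku.lintegral_prod_right'
  set E := {x | l < ∫⁻ y, k x y * u y ∂σ} with hE
  have hEm : MeasurableSet E := measurableSet_lt measurable_const hT
  by_cases h0 : μ E = 0
  · simp [h0]
  have hfin : μ E ≠ ⊤ := measure_ne_top _ _
  have h1 : l * μ E ≤ μ E ^ (1 - 1 / s) * (K * ∫⁻ y, u y ∂σ) := by
    calc l * μ E = ∫⁻ _ in E, l ∂μ := by simp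
      _ ≤ ∫⁻ x in E, ∫⁻ y, k x y * u y ∂σ ∂μ := setLIntegral_mono' hEm fun x hx => le_of_lt hx
      _ = ∫⁻ y, ∫⁻ x in E, k x y * u y ∂μ ∂σ := lintegral_lintegral_swap hku.aemeasurable
      _ ≤ ∫⁻ y, μ E ^ (1 - 1 / s) * K * u y ∂σ := by
        apply lintegral_mono_ae
        filter_upwards [hK E hEm] with y hy
        have hky : Measurable fun x => k x y := hk.comp measurable_prodMk_right
        rw [lintegral_mul_const _ hky, mul_comm (μ E ^ _)]
        gcongr
      _ = _ := by rw [lintegral_const_mul _ hu, mul_assoc]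
  have h2 : μ E = μ E ^ (1 - 1 / s) * μ E ^ (1 / s) := by
    rw [← ENNReal.rpow_add _ _ h0 hfin]; simp
  have h3 : l * μ E ^ (1 / s) ≤ K * ∫⁻ y, u y ∂σ := by
    have hexp : 0 ≤ 1 - 1 / s := by
      rw [sub_nonneg, div_le_one hs0]; exact hs.le
    refine (ENNReal.mul_le_mul_iff_right (ENNReal.rpow_pos (pos_iff_ne_zero.2 h0) hfin).ne'
      (ENNReal.rpow_ne_top_of_nonneg hexp hfin)).1 (le_trans (le_of_eq ?_) h1)
    rw [mul_left_comm, ← h2]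
  calc l ^ s * μ E = (l * μ E ^ (1 / s)) ^ s := by
        rw [ENNReal.mul_rpow_of_nonneg _ _ hs0.le, ← ENNReal.rpow_mul,
          one_div_mul_cancel hs0.ne', ENNReal.rpow_one]
    _ ≤ _ := ENNReal.rpow_le_rpow h3 hs0.le

/-- A kernel operator which is bounded on `L^∞` and of weak type `(1, s)` maps `L²` to
`L^{2s}`. -/
theorem lintegral_kernel_rpow_le {μ : Measure X} [IsFiniteMeasure μ] {σ : Measure Y} [SFinite σ]
    {k : X → Y → ℝ≥0∞} (hk : Measurable (Function.uncurry k)) {B K : ℝ≥0∞} (hB : B ≠ ⊤)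
    {s : ℝ} (hs : 1 < s) (hkB : ∀ᵐ x ∂μ, ∫⁻ y, k x y ∂σ ≤ B)
    (hK : ∀ E, MeasurableSet E → ∀ᵐ y ∂σ, ∫⁻ x in E, k x y ∂μ ≤ K * μ E ^ (1 - 1 / s))
    {u : Y → ℝ≥0∞} (hu : Measurable u) :
    ∫⁻ x, (∫⁻ y, k x y * u y ∂σ) ^ (2 * s) ∂μ ≤
      ENNReal.ofReal (2 * s) * (B + 1) ^ (2 * s) * K ^ s * (∫⁻ y, u y ^ 2 ∂σ) ^ s := by
  have hs0 : 0 < s := by linarith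
  set D := B + 1 with hD
  have hD0 : D ≠ 0 := by simp [hD]
  have hDt : D ≠ ⊤ := by simp [hD, hB]
  set Q := ∫⁻ y, u y ^ 2 ∂σ with hQ
  have hku : Measurable (Function.uncurry fun x y => k x y * u y) :=
    hk.mul (hu.comp measurable_snd)
  have hT : Measurable fun x => ∫⁻ y, k x y * u y ∂σ := hku.lintegral_prod_right'
  set T : X → ℝ≥0∞ := fun x => ∫⁻ y, k x y * u y ∂σ with hTdef
  let v : ℝ → Y → ℝ≥0∞ := fun t => {y | ENNReal.ofReal t < D * u y}.indicator u
  have hset : ∀ t : ℝ, MeasurableSet {y | ENNReal.ofReal t < D * u y} := fun t =>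
    measurableSet_lt measurable_const (hu.const_mul D)
  have hv : ∀ t, Measurable (v t) := fun t => hu.indicator (hset t)
  have level : ∀ t : ℝ, 0 < t → ENNReal.ofReal (t ^ (2 * s - 1)) * μ {x | ENNReal.ofReal t < T x} ≤
      D ^ (2 * s - 1) * K ^ s * Q ^ (s - 1) * ∫⁻ y, v t y ∂σ := by
    intro t ht
    set l := ENNReal.ofReal t / D with hl
    have hl0 : l ≠ 0 := by simp [hl, ht, hDt]
    have hlt : l ≠ ⊤ := ENNReal.div_ne_top ENNReal.ofReal_ne_top hD0
    have htl : ENNReal.ofReal t = D * l := by rw [hl, ENNReal.mul_div_cancel hD0 hDt]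
    have hvl : ∀ y, u y ≤ l + v t y := by
      intro y
      by_cases hy : y ∈ {y | ENNReal.ofReal t < D * u y}
      · simp [v, indicator_of_mem hy]
      · simp only [v, indicator_of_notMem hy, add_zero]
        have : D * u y ≤ D * l := by rw [← htl]; exact not_lt.1 hy
        exact (ENNReal.mul_le_mul_iff_right hD0 hDt).1 this
    have hincl : μ {x | ENNReal.ofReal t < T x} ≤ μ {x | l < ∫⁻ y, k x y * v t y ∂σ} := by
      apply measure_mono_ae
      filter_upwards [hkB] with x hx hTx
      have hTx' : ENNReal.ofReal t < T x := hTx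
      have h1 : T x ≤ B * l + ∫⁻ y, k x y * v t y ∂σ := by
        have hkx : Measurable (k x) := hk.comp measurable_prodMk_left
        calc T x ≤ ∫⁻ y, (k x y * l + k x y * v t y) ∂σ := by
              apply lintegral_mono
              intro y
              beta_reduce
              rw [← mul_add]
              gcongr
              exact hvl y
          _ = (∫⁻ y, k x y ∂σ) * l + ∫⁻ y, k x y * v t y ∂σ := by
              rw [lintegral_add_left (hkx.mul_const l), lintegral_mul_const _ hkx]
          _ ≤ _ := by gcongr
      have h2 : B * l + l < B * l + ∫⁻ y, k x y * v t y ∂σ := by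
        refine lt_of_le_of_lt (le_of_eq ?_) (hTx'.trans_le h1)
        rw [htl, hD, add_mul, one_mul]
      exact (ENNReal.add_lt_add_iff_left (ENNReal.mul_ne_top hB hlt)).1 h2
    have hweak := meas_kernel_lt_le hk hs hK (hv t) l
    have hcheb : l * ∫⁻ y, v t y ∂σ ≤ Q := by
      rw [← lintegral_const_mul _ (hv t)]
      apply lintegral_mono
      intro y
      by_cases hy : y ∈ {y | ENNReal.ofReal t < D * u y}
      · simp only [v, indicator_of_mem hy, sq]
        gcongr
        have : D * l ≤ D * u y := by rw [← htl]; exact le_of_lt hy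
        exact (ENNReal.mul_le_mul_iff_right hD0 hDt).1 this
      · simp [v, indicator_of_notMem hy]
    set I := ∫⁻ y, v t y ∂σ
    have hI : I ^ s = I ^ (s - 1) * I := by
      nth_rw 3 [← ENNReal.rpow_one I]
      rw [← ENNReal.rpow_add_of_nonneg _ _ (by linarith) zero_le_one]; simp
    have hl2 : l ^ (2 * s - 1) = l ^ (s - 1) * l ^ s := by
      rw [← ENNReal.rpow_add_of_nonneg _ _ (by linarith) (by linarith)]; congr 1; ring
    rw [← ENNReal.ofReal_rpow_of_pos ht, htl, ENNReal.mul_rpow_of_nonneg _ _ (by linarith), hl2]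
    rw [← htl]
    calc D ^ (2 * s - 1) * (l ^ (s - 1) * l ^ s) * μ {x | ENNReal.ofReal t < T x}
        ≤ D ^ (2 * s - 1) * (l ^ (s - 1) * l ^ s) * μ {x | l < ∫⁻ y, k x y * v t y ∂σ} := by
          gcongr
      _ = D ^ (2 * s - 1) * l ^ (s - 1) * (l ^ s * μ {x | l < ∫⁻ y, k x y * v t y ∂σ}) := by ring
      _ ≤ D ^ (2 * s - 1) * l ^ (s - 1) * (K * I) ^ s := by gcongr
      _ = D ^ (2 * s - 1) * K ^ s * (l * I) ^ (s - 1) * I := by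
          rw [ENNReal.mul_rpow_of_nonneg _ _ hs0.le, hI,
            ENNReal.mul_rpow_of_nonneg _ _ (by linarith : 0 ≤ s - 1)]
          ring
      _ ≤ _ := by gcongr
  have hjoint : MeasurableSet {p : X × ℝ | ENNReal.ofReal p.2 < T p.1} :=
    measurableSet_lt measurable_snd.ennreal_ofReal (hT.comp measurable_fst)
  have hjoint' : MeasurableSet {p : ℝ × Y | ENNReal.ofReal p.1 < D * u p.2} :=
    measurableSet_lt measurable_fst.ennreal_ofReal ((hu.comp measurable_snd).const_mul D)
  have hswap : ∫⁻ x, (∫⁻ t in Ioi (0 : ℝ), {t : ℝ | ENNReal.ofReal t < T x}.indicator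
        (fun t => ENNReal.ofReal (t ^ (2 * s - 1))) t) ∂μ =
      ∫⁻ t in Ioi (0 : ℝ), ENNReal.ofReal (t ^ (2 * s - 1)) * μ {x | ENNReal.ofReal t < T x} := by
    rw [lintegral_lintegral_swap]
    · congr with t
      have : ∀ x, {t : ℝ | ENNReal.ofReal t < T x}.indicator
          (fun t => ENNReal.ofReal (t ^ (2 * s - 1))) t =
          {x | ENNReal.ofReal t < T x}.indicator (fun _ => ENNReal.ofReal (t ^ (2 * s - 1))) x :=
        fun x => rfl
      simp only [this]
      rw [lintegral_indicator_const (measurableSet_lt measurable_const hT)]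
    · have : Measurable ({p : X × ℝ | ENNReal.ofReal p.2 < T p.1}.indicator
          fun p => ENNReal.ofReal (p.2 ^ (2 * s - 1))) :=
        (measurable_snd.pow_const _).ennreal_ofReal.indicator hjoint
      exact this.aemeasurable
  have hswap' : ∫⁻ t in Ioi (0 : ℝ), ∫⁻ y, v t y ∂σ ≤ D * Q := by
    rw [lintegral_lintegral_swap]
    · rw [hQ, ← lintegral_const_mul _ (hu.pow_const 2)]
      apply lintegral_mono
      intro y
      have h1 : ∀ t, v t y = {t : ℝ | ENNReal.ofReal t < D * u y}.indicator (fun _ => u y) t :=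
        fun t => rfl
      simp only [h1]
      rw [lintegral_indicator_const
        (measurableSet_lt ENNReal.measurable_ofReal measurable_const), sq, ← mul_assoc, mul_comm]
      gcongr
      rw [Measure.restrict_apply (measurableSet_lt ENNReal.measurable_ofReal measurable_const)]
      by_cases htop : D * u y = ⊤
      · rw [htop]; exact le_top
      · calc volume ({t | ENNReal.ofReal t < D * u y} ∩ Ioi 0)
            ≤ volume (Ioo 0 (D * u y).toReal) := by
              apply measure_mono
              rintro t ⟨ht, ht0⟩
              exact ⟨ht0, (ENNReal.ofReal_lt_iff_lt_toReal (le_of_lt ht0) htop).1 ht⟩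
          _ = D * u y := by rw [Real.volume_Ioo, sub_zero, ENNReal.ofReal_toReal htop]
    · have : Measurable ({p : ℝ × Y | ENNReal.ofReal p.1 < D * u p.2}.indicator fun p => u p.2) :=
        (hu.comp measurable_snd).indicator hjoint'
      exact this.aemeasurable
  have hvm : Measurable fun t => ∫⁻ y, v t y ∂σ := by
    have : Measurable ({p : ℝ × Y | ENNReal.ofReal p.1 < D * u p.2}.indicator fun p => u p.2) :=
      (hu.comp measurable_snd).indicator hjoint'
    exact this.lintegral_prod_right'
  calc ∫⁻ x, T x ^ (2 * s) ∂μ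
      ≤ ∫⁻ x, ENNReal.ofReal (2 * s) * (∫⁻ t in Ioi (0 : ℝ), {t : ℝ | ENNReal.ofReal t < T x}.indicator
        (fun t => ENNReal.ofReal (t ^ (2 * s - 1))) t) ∂μ :=
        lintegral_mono fun x => rpow_le_lintegral_layer (by linarith) (T x)
    _ = ENNReal.ofReal (2 * s) * ∫⁻ t in Ioi (0 : ℝ),
          ENNReal.ofReal (t ^ (2 * s - 1)) * μ {x | ENNReal.ofReal t < T x} := by
        rw [lintegral_const_mul' _ _ ENNReal.ofReal_ne_top, hswap]
    _ ≤ ENNReal.ofReal (2 * s) * ∫⁻ t in Ioi (0 : ℝ),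
          D ^ (2 * s - 1) * K ^ s * Q ^ (s - 1) * ∫⁻ y, v t y ∂σ := by
        exact mul_le_mul' le_rfl (setLIntegral_mono' measurableSet_Ioi fun t ht => level t ht)
    _ ≤ ENNReal.ofReal (2 * s) * (D ^ (2 * s - 1) * K ^ s * Q ^ (s - 1) * (D * Q)) := by
        rw [lintegral_const_mul _ hvm]
        gcongr
    _ = ENNReal.ofReal (2 * s) * (D ^ (2 * s - 1) * D) * K ^ s * (Q ^ (s - 1) * Q) := by ring
    _ = _ := by
        have h1 : ∀ (x : ℝ≥0∞) (b : ℝ), 1 ≤ b → x ^ (b - 1) * x = x ^ b := fun x b hb => by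
          nth_rw 2 [← ENNReal.rpow_one x]
          rw [← ENNReal.rpow_add_of_nonneg _ _ (by linarith) zero_le_one]; simp
        rw [h1 _ _ (by linarith), h1 _ _ hs.le]

end KernelOperators

section CarlesonSufficient

theorem setLIntegral_rpow_neg_le_measure_rpow {X : Type*} [MeasurableSpace X] {m : Measure X}
    [IsFiniteMeasure m] {d : X → ℝ} (hd : Measurable d) (hd0 : ∀ x, 0 ≤ d x) {A α β : ℝ}
    (hA : 0 ≤ A) (hβ : 0 < β) (hαβ : β < α)
    (hm : ∀ t > 0, m {x | d x < t} ≤ ENNReal.ofReal (A * t ^ α)) (E : Set X) :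
    ∫⁻ x in E, ENNReal.ofReal (d x ^ (-β)) ∂m ≤
      ENNReal.ofReal (A * 2 ^ (α + β) * (1 - (1 / 2) ^ (α - β))⁻¹ + 1) * m E ^ (1 - β / α) := by
  have hα : 0 < α := hβ.trans hαβ
  by_cases h0 : m E = 0
  · rw [setLIntegral_measure_zero _ _ h0]; exact zero_le
  have hfin : m E ≠ ⊤ := measure_ne_top _ _
  set b := (m E).toReal with hb
  have hb0 : 0 < b := ENNReal.toReal_pos h0 hfin
  have hEb : m E = ENNReal.ofReal b := (ENNReal.ofReal_toReal hfin).symm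
  set t := b ^ (1 / α) with ht
  have ht0 : 0 < t := Real.rpow_pos_of_pos hb0 _
  set A' := A * 2 ^ (α + β) * (1 - (1 / 2) ^ (α - β))⁻¹ with hA'
  have h2 : (1 / 2 : ℝ) ^ (α - β) < 1 :=
    Real.rpow_lt_one (by norm_num) (by norm_num) (by linarith)
  have hA'0 : 0 ≤ A' := by
    have : 0 ≤ (1 - (1 / 2 : ℝ) ^ (α - β))⁻¹ := inv_nonneg.2 (by linarith)
    positivity
  have htb : t ^ (α - β) = b ^ (1 - β / α) := by
    rw [ht, ← Real.rpow_mul hb0.le]; congr 1; field_simp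
  have htb' : t ^ (-β) * b = b ^ (1 - β / α) := by
    rw [ht, ← Real.rpow_mul hb0.le]
    nth_rw 2 [← Real.rpow_one b]
    rw [← Real.rpow_add hb0]; congr 1; field_simp; ring
  have hS : MeasurableSet {x | d x < t} := measurableSet_lt hd measurable_const
  calc ∫⁻ x in E, ENNReal.ofReal (d x ^ (-β)) ∂m
      = ∫⁻ x in {x | d x < t}, ENNReal.ofReal (d x ^ (-β)) ∂m.restrict E +
          ∫⁻ x in {x | d x < t}ᶜ, ENNReal.ofReal (d x ^ (-β)) ∂m.restrict E :=
        (lintegral_add_compl _ hS).symm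
    _ ≤ ENNReal.ofReal (A' * b ^ (1 - β / α)) + ENNReal.ofReal (b ^ (1 - β / α)) := by
        apply add_le_add
        · calc _ ≤ ∫⁻ x in {x | d x < t}, ENNReal.ofReal (d x ^ (-β)) ∂m :=
                lintegral_mono' (Measure.restrict_mono_measure Measure.restrict_le_self _) le_rfl
            _ ≤ _ := by
                refine (setLIntegral_rpow_neg_near_le hd hd0 hA hβ hαβ ht0 hm).trans
                  (ENNReal.ofReal_le_ofReal (le_of_eq ?_))
                rw [htb, hA']; ring
        · calc _ ≤ ∫⁻ x in {x | d x < t}ᶜ, ENNReal.ofReal (t ^ (-β)) ∂m.restrict E := by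
                apply setLIntegral_mono' hS.compl
                intro x hx
                have hx' : t ≤ d x := not_lt.1 hx
                exact ENNReal.ofReal_le_ofReal
                  (Real.rpow_le_rpow_of_nonpos ht0 hx' (by linarith))
            _ ≤ ENNReal.ofReal (t ^ (-β)) * m E := by
                rw [lintegral_const]
                refine mul_le_mul' le_rfl ?_
                rw [Measure.restrict_apply_univ]
                exact (measure_mono (subset_univ _)).trans_eq (by simp)
            _ = _ := by
                rw [hEb, ← ENNReal.ofReal_mul (by positivity), htb']
    _ = _ := by
        have hexp : 0 ≤ 1 - β / α := by
          rw [sub_nonneg, div_le_one hα]; exact hαβ.le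
        rw [hEb, ENNReal.ofReal_rpow_of_pos hb0, ← ENNReal.ofReal_add (by positivity)
          (by positivity), ← ENNReal.ofReal_mul (by positivity)]
        congr 1; ring

variable {n : ℕ}

theorem measurable_ballKer : Measurable (Function.uncurry (ballKer (n := n))) := by
  have h1 : Measurable fun p : En n × En n => korDist p.2 p.1 :=
    measurable_korDist_comp measurable_snd measurable_fst
  exact ((measurable_const.sub measurable_fst.norm).pow_const n).div (h1.pow_const (2 * n))

theorem exists_lintegral_ballKer_le (hn : 1 ≤ n) : ∃ C : ℝ, 0 < C ∧ ∀ z ∈ Bn n,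
    ∫⁻ ζ, ENNReal.ofReal (ballKer z ζ) ∂sigmaS n ≤ ENNReal.ofReal C := by
  have hn' : (0 : ℝ) < n := by exact_mod_cast hn
  obtain ⟨C, hC, h⟩ := lintegral_korDist_rpow_le hn (M := 2 * n) (by linarith)
  refine ⟨C, hC, fun z hz => ?_⟩
  have hδ : 0 < 1 - ‖z‖ := by linarith [mem_Bn.1 hz]
  have hk : ∀ ζ, ENNReal.ofReal (ballKer z ζ) = ENNReal.ofReal ((1 - ‖z‖) ^ n) *
      ENNReal.ofReal (korDist ζ z ^ (-(2 * n : ℝ))) := fun ζ => by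
    rw [← ENNReal.ofReal_mul (by positivity), ballKer, Real.rpow_neg (korDist_nonneg _ _),
      div_eq_mul_inv]
    norm_cast
  simp only [hk]
  rw [lintegral_const_mul' _ _ ENNReal.ofReal_ne_top]
  calc _ ≤ ENNReal.ofReal ((1 - ‖z‖) ^ n) *
        ENNReal.ofReal (C * (1 - ‖z‖) ^ ((n : ℝ) - 2 * n)) := by gcongr; exact h z hz
    _ = ENNReal.ofReal C := by
        rw [← ENNReal.ofReal_mul (by positivity), mul_left_comm, ← Real.rpow_natCast,
          ← Real.rpow_add hδ]
        ring_nf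
        simp

theorem ballKer_le {z ζ : En n} (hz : z ∈ Bn n) (hζ : ζ ∈ Sn n) :
    ballKer z ζ ≤ korDist z ζ ^ (-(n : ℝ)) := by
  have hδ : 0 < 1 - ‖z‖ := by linarith [mem_Bn.1 hz]
  have h1 := one_sub_norm_le_korDist (z := z) (norm_of_mem_Sn hζ).le
  have h0 := hδ.trans_le h1
  rw [ballKer, korDist_comm, Real.rpow_neg h0.le, Real.rpow_natCast, div_le_iff₀ (by positivity),
    two_mul, pow_add, inv_mul_cancel_left₀ (by positivity)]
  gcongr

theorem setLIntegral_ballKer_le_of_isSCarleson (hn : 1 ≤ n) {μ : Measure (En n)}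
    [IsFiniteMeasure μ] (hμ : μ (Bn n)ᶜ = 0) {s : ℝ} (hs : 1 < s) (hC : IsSCarleson n s μ) :
    ∃ K : ℝ, 0 < K ∧ ∀ ζ ∈ Sn n, ∀ E : Set (En n),
      ∫⁻ z in E, ENNReal.ofReal (ballKer z ζ) ∂μ ≤ ENNReal.ofReal K * μ E ^ (1 - 1 / s) := by
  obtain ⟨C, hCt, hC⟩ := hC
  have hn' : (0 : ℝ) < n := by exact_mod_cast hn
  have hαβ : (n : ℝ) < n * s := by nlinarith
  have h2 : (1 / 2 : ℝ) ^ (n * s - n) < 1 :=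
    Real.rpow_lt_one (by norm_num) (by norm_num) (by linarith)
  have h2' : 0 ≤ (1 - (1 / 2 : ℝ) ^ (n * s - n))⁻¹ := inv_nonneg.2 (by linarith)
  refine ⟨C.toReal * 2 ^ (n * s + n) * (1 - (1 / 2) ^ (n * s - n))⁻¹ + 1, by positivity,
    fun ζ hζ E => ?_⟩
  have hae : ∀ᵐ z ∂μ, z ∈ Bn n := by
    rw [ae_iff]; exact hμ
  have hm : ∀ t > 0, μ {z | korDist z ζ < t} ≤ ENNReal.ofReal (C.toReal * t ^ (n * s)) := by
    intro t ht
    rw [ENNReal.ofReal_mul ENNReal.toReal_nonneg, ENNReal.ofReal_toReal hCt.ne]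
    refine le_trans (measure_mono_ae ?_) (hC ζ hζ t ht)
    filter_upwards [hae] with z hz hz'
    exact ⟨hz, hz'⟩
  have h := setLIntegral_rpow_neg_le_measure_rpow
    (measurable_korDist_comp measurable_id measurable_const) (fun z => korDist_nonneg z ζ)
    ENNReal.toReal_nonneg hn' hαβ hm E
  have hexp : (n : ℝ) / (n * s) = 1 / s := by field_simp
  rw [hexp] at h
  refine le_trans (lintegral_mono_ae ?_) h
  filter_upwards [ae_restrict_of_ae hae] with z hz
  exact ENNReal.ofReal_le_ofReal (ballKer_le hz hζ)

theorem ofReal_norm_rpow (x : ℂ) {a : ℝ} (ha : 0 ≤ a) :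
    ENNReal.ofReal (‖x‖ ^ a) = (‖x‖₊ : ℝ≥0∞) ^ a := by
  rw [← ENNReal.ofReal_rpow_of_nonneg (norm_nonneg x) ha, ofReal_norm, enorm_eq_nnnorm]

theorem exists_lintegral_dilate_le (hn : 1 ≤ n) {μ : Measure (En n)} [IsFiniteMeasure μ]
    (hμ : μ (Bn n)ᶜ = 0) {p q : ℝ} (hp : 0 < p) (hpq : p < q) (hC : IsSCarleson n (q / p) μ) :
    ∃ C : ℝ≥0∞, C < ⊤ ∧ ∀ F : En n → ℂ, Measurable F → DifferentiableOn ℂ F (Bn n) →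
      ∀ r ∈ Ioo (0 : ℝ) 1, ∫⁻ z, (‖F (r • z)‖₊ : ℝ≥0∞) ^ q ∂μ ≤ C * hNorm n p F ^ q := by
  have := isProbabilityMeasure_sigmaS hn
  have hs : 1 < q / p := (one_lt_div hp).2 hpq
  have hs0 : 0 < q / p := by linarith
  obtain ⟨D, hD, hsub⟩ := rpow_norm_le_lintegral_ballKer hn (half_pos hp)
  obtain ⟨B, hB, hkB⟩ := exists_lintegral_ballKer_le hn
  obtain ⟨K, hK, hkK⟩ := setLIntegral_ballKer_le_of_isSCarleson hn hμ hs hC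
  have hae : ∀ᵐ z ∂μ, z ∈ Bn n := by
    rw [ae_iff]; exact hμ
  set s := q / p with hsdef
  refine ⟨ENNReal.ofReal D ^ (2 * s) * (ENNReal.ofReal (2 * s) * (ENNReal.ofReal B + 1) ^ (2 * s) *
    ENNReal.ofReal K ^ s), ?_, fun F hFm hF r hr => ?_⟩
  · refine ENNReal.mul_lt_top (ENNReal.rpow_lt_top_of_nonneg (by positivity)
      ENNReal.ofReal_ne_top) (ENNReal.mul_lt_top (ENNReal.mul_lt_top ENNReal.ofReal_lt_top ?_) ?_)
    · exact ENNReal.rpow_lt_top_of_nonneg (by positivity) (by simp)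
    · exact ENNReal.rpow_lt_top_of_nonneg (by positivity) ENNReal.ofReal_ne_top
  have hrm : Measurable fun ζ => F (r • ζ) := hFm.comp (measurable_const_smul r)
  have hu : Measurable fun ζ => ENNReal.ofReal (‖F (r • ζ)‖ ^ (p / 2)) :=
    (hrm.norm.pow_const _).ennreal_ofReal
  have hmain := lintegral_kernel_rpow_le (μ := μ) (σ := sigmaS n)
    (k := fun z ζ => ENNReal.ofReal (ballKer z ζ)) measurable_ballKer.ennreal_ofReal
    ENNReal.ofReal_ne_top hs (hae.mono hkB)
    (fun E _ => (ae_mem_Sn n).mono fun ζ hζ => hkK ζ hζ E) hu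
  have hsq : ∀ x : ℂ, ENNReal.ofReal (‖x‖ ^ (p / 2)) ^ 2 = (‖x‖₊ : ℝ≥0∞) ^ p := fun x => by
    rw [ofReal_norm_rpow x (by positivity), ← ENNReal.rpow_mul_natCast]
    congr 1; push_cast; ring
  have hq : ∀ x : ℂ, ENNReal.ofReal (‖x‖ ^ (p / 2)) ^ (2 * s) = (‖x‖₊ : ℝ≥0∞) ^ q := fun x => by
    rw [ofReal_norm_rpow x (by positivity), ← ENNReal.rpow_mul]
    congr 1; rw [hsdef]; field_simp
  have hnorm : (∫⁻ ζ, (‖F (r • ζ)‖₊ : ℝ≥0∞) ^ p ∂sigmaS n) ^ s ≤ hNorm n p F ^ q := by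
    have hle : ∫⁻ ζ, (‖F (r • ζ)‖₊ : ℝ≥0∞) ^ p ∂sigmaS n ≤
        ⨆ r ∈ Ioo (0 : ℝ) 1, ∫⁻ ζ, (‖F (r • ζ)‖₊ : ℝ≥0∞) ^ p ∂sigmaS n :=
      le_iSup₂ (f := fun (r : ℝ) (_ : r ∈ Ioo (0 : ℝ) 1) =>
        ∫⁻ ζ, (‖F (r • ζ)‖₊ : ℝ≥0∞) ^ p ∂sigmaS n) r hr
    rw [hNorm, ← ENNReal.rpow_mul, one_div_mul_eq_div]
    exact ENNReal.rpow_le_rpow hle hs0.le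
  simp only [hsq] at hmain
  calc ∫⁻ z, (‖F (r • z)‖₊ : ℝ≥0∞) ^ q ∂μ
      ≤ ∫⁻ z, ENNReal.ofReal D ^ (2 * s) * (∫⁻ ζ, ENNReal.ofReal (ballKer z ζ) *
          ENNReal.ofReal (‖F (r • ζ)‖ ^ (p / 2)) ∂sigmaS n) ^ (2 * s) ∂μ := by
        apply lintegral_mono_ae
        filter_upwards [hae] with z hz
        rw [← hq, ← ENNReal.mul_rpow_of_nonneg _ _ (by positivity)]
        exact ENNReal.rpow_le_rpow (hsub F hFm hF r hr.1 hr.2 z hz) (by positivity)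
    _ = ENNReal.ofReal D ^ (2 * s) * ∫⁻ z, (∫⁻ ζ, ENNReal.ofReal (ballKer z ζ) *
          ENNReal.ofReal (‖F (r • ζ)‖ ^ (p / 2)) ∂sigmaS n) ^ (2 * s) ∂μ :=
        lintegral_const_mul' _ _ (ENNReal.rpow_ne_top_of_nonneg (by positivity)
          ENNReal.ofReal_ne_top)
    _ ≤ _ := by
        rw [mul_assoc]
        gcongr
        exact hmain.trans (mul_le_mul' le_rfl hnorm)

theorem measurable_indicator_Bn {f : En n → ℂ} (hf : DifferentiableOn ℂ f (Bn n)) :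
    Measurable ((Bn n).indicator f) := by
  classical
  have hB : MeasurableSet (Bn n) := isOpen_ball.measurableSet
  have h : Measurable ((Bn n).piecewise f 0) :=
    hf.continuousOn.measurable_piecewise continuousOn_const hB
  rwa [piecewise_eq_indicator] at h

theorem hNorm_indicator_Bn (p : ℝ) (f : En n → ℂ) :
    hNorm n p ((Bn n).indicator f) = hNorm n p f := by
  unfold hNorm
  congr 1
  refine iSup_congr fun r => iSup_congr fun hr => lintegral_congr_ae ?_
  filter_upwards [ae_mem_Sn n] with ζ hζ
  have : r • ζ ∈ Bn n := by
    rw [mem_Bn, norm_smul, norm_of_mem_Sn hζ, mul_one, Real.norm_of_nonneg hr.1.le]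
    exact hr.2
  rw [indicator_of_mem this]

theorem exists_lintegral_le_hNorm_of_isSCarleson (hn : 1 ≤ n) {μ : Measure (En n)}
    [IsFiniteMeasure μ] (hμ : μ (Bn n)ᶜ = 0) {p q : ℝ} (hp : 0 < p) (hpq : p < q)
    (hC : IsSCarleson n (q / p) μ) :
    ∃ C : ℝ≥0∞, 0 < C ∧ C < ⊤ ∧ ∀ f, MemHp n p f →
      ∫⁻ z, (‖f z‖₊ : ℝ≥0∞) ^ q ∂μ ≤ C * hNorm n p f ^ q := by
  obtain ⟨C, hCt, h⟩ := exists_lintegral_dilate_le hn hμ hp hpq hC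
  have hae : ∀ᵐ z ∂μ, z ∈ Bn n := by
    rw [ae_iff]; exact hμ
  refine ⟨C + 1, by simp, by simp [hCt], fun f hf => ?_⟩
  set F := (Bn n).indicator f with hFdef
  have hFm : Measurable F := measurable_indicator_Bn hf.1
  have hF : DifferentiableOn ℂ F (Bn n) := hf.1.congr fun z hz => indicator_of_mem hz f
  obtain ⟨r, -, hr, hr1⟩ := exists_seq_strictMono_tendsto' (zero_lt_one (α := ℝ))
  have hbound : ∀ k, ∫⁻ z, (‖F (r k • z)‖₊ : ℝ≥0∞) ^ q ∂μ ≤ C * hNorm n p f ^ q := fun k => by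
    rw [← hNorm_indicator_Bn]; exact h F hFm hF (r k) (hr k)
  have hmeas : ∀ k, Measurable fun z => (‖F (r k • z)‖₊ : ℝ≥0∞) ^ q := fun k =>
    (hFm.comp (measurable_const_smul (r k))).nnnorm.coe_nnreal_ennreal.pow_const q
  calc ∫⁻ z, (‖f z‖₊ : ℝ≥0∞) ^ q ∂μ
      = ∫⁻ z, liminf (fun k => (‖F (r k • z)‖₊ : ℝ≥0∞) ^ q) atTop ∂μ := by
        apply lintegral_congr_ae
        filter_upwards [hae] with z hz
        have hc : ContinuousAt F z :=
          (hF.differentiableAt (isOpen_ball.mem_nhds hz)).continuousAt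
        have h1 : Tendsto (fun k => r k • z) atTop (𝓝 z) := by
          simpa using hr1.smul_const z
        have h2 : Tendsto (fun k => (‖F (r k • z)‖₊ : ℝ≥0∞) ^ q) atTop
            (𝓝 ((‖F z‖₊ : ℝ≥0∞) ^ q)) :=
          ((ENNReal.continuous_rpow_const.comp
            (ENNReal.continuous_coe.comp continuous_nnnorm)).tendsto (F z)).comp
            (hc.tendsto.comp h1)
        rw [h2.liminf_eq, hFdef, indicator_of_mem hz]
    _ ≤ liminf (fun k => ∫⁻ z, (‖F (r k • z)‖₊ : ℝ≥0∞) ^ q ∂μ) atTop :=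
        lintegral_liminf_le hmeas
    _ ≤ liminf (fun _ : ℕ => C * hNorm n p f ^ q) atTop :=
        liminf_le_liminf (Eventually.of_forall hbound)
    _ = C * hNorm n p f ^ q := liminf_const _
    _ ≤ _ := by gcongr; exact le_self_add

end CarlesonSufficient

section CarlesonNecessary

variable {n : ℕ}

theorem isOpen_cBox (ζ : En n) (δ : ℝ) : IsOpen (cBox ζ δ) :=
  isOpen_ball.inter (isOpen_lt
    (continuous_const.sub (Continuous.herm continuous_id continuous_const)).norm continuous_const)

theorem nnnorm_inv_pow_rpow (x : ℂ) (N : ℕ) {a : ℝ} (ha : 0 ≤ a) :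
    (‖(x ^ N)⁻¹‖₊ : ℝ≥0∞) ^ a = ENNReal.ofReal (‖x‖ ^ (-(N * a))) := by
  rw [← ofReal_norm_rpow _ ha, norm_inv, norm_pow, Real.inv_rpow (by positivity),
    ← Real.rpow_natCast, ← Real.rpow_mul (norm_nonneg x), Real.rpow_neg (norm_nonneg x)]

theorem differentiableOn_inv_one_sub_herm_pow {a : En n} (ha : ‖a‖ ≤ 1) (N : ℕ) :
    DifferentiableOn ℂ (fun w => (((1 : ℂ) - herm w a) ^ N)⁻¹) (Bn n) := by
  have h : Differentiable ℂ fun w : En n => herm w a := by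
    simp only [herm_eq_inner]; exact (innerSL ℂ a).differentiable
  refine (((differentiable_const _).sub h).pow N).differentiableOn.inv fun w hw => pow_ne_zero _ ?_
  refine norm_ne_zero_iff.1 (ne_of_gt (a := ‖(1 : ℂ) - herm w a‖) ?_)
  have := one_sub_norm_le_korDist (z := w) ha
  have := mem_Bn.1 hw
  unfold korDist at *
  linarith

theorem exists_hNorm_inv_one_sub_herm_pow_le (hn : 1 ≤ n) {p : ℝ} (hp : 0 < p) {N : ℕ}
    (hN : (n : ℝ) < N * p) : ∃ C : ℝ, 0 < C ∧ ∀ a ∈ Bn n,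
      hNorm n p (fun w => (((1 : ℂ) - herm w a) ^ N)⁻¹) ≤
        ENNReal.ofReal (C * (1 - ‖a‖) ^ ((n : ℝ) - N * p)) ^ (1 / p) := by
  obtain ⟨C, hC, h⟩ := lintegral_korDist_rpow_le hn hN
  refine ⟨C, hC, fun a ha => ENNReal.rpow_le_rpow (iSup₂_le fun r hr => ?_) (by positivity)⟩
  have ha1 := mem_Bn.1 ha
  have hra : ‖r • a‖ ≤ ‖a‖ := by
    rw [norm_smul, Real.norm_of_nonneg hr.1.le]
    exact mul_le_of_le_one_left (norm_nonneg a) hr.2.le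
  have hk : ∀ η, herm (r • η) a = herm η (r • a) := fun η => by
    simp only [herm_eq_inner, inner_smul_left_eq_star_smul, inner_smul_right_eq_smul, conj_trivial]
  simp only [nnnorm_inv_pow_rpow _ _ hp.le, hk]
  refine (h (r • a) (mem_Bn.2 (hra.trans_lt ha1))).trans (ENNReal.ofReal_le_ofReal ?_)
  gcongr ?_ * ?_
  exact Real.rpow_le_rpow_of_nonpos (by linarith) (by linarith) (by linarith)

theorem korDist_smul_lt_two_mul {ζ : En n} (hζ : ζ ∈ Sn n) {δ : ℝ} (hδ : 0 < δ) {z : En n}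
    (hz : z ∈ cBox ζ δ) : ‖(1 : ℂ) - herm z ((1 - δ) • ζ)‖ < 2 * δ := by
  have h1 : herm z ((1 - δ) • ζ) = herm z ζ - δ * herm z ζ := by
    rw [herm_eq_inner, herm_eq_inner, inner_smul_left_eq_star_smul, conj_trivial, sub_smul,
      one_smul, Complex.real_smul]
  have h2 : ‖(δ : ℂ) * herm z ζ‖ ≤ δ := by
    rw [norm_mul, Complex.norm_of_nonneg hδ.le]
    refine mul_le_of_le_one_right hδ.le ((norm_herm_le z ζ).trans ?_)
    rw [norm_of_mem_Sn hζ, mul_one]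
    exact (mem_Bn.1 hz.1).le
  rw [h1, ← sub_add]
  linarith [norm_add_le ((1 : ℂ) - herm z ζ) (δ * herm z ζ), hz.2]

theorem isSCarleson_of_lintegral_le_hNorm (hn : 1 ≤ n) {μ : Measure (En n)} [IsFiniteMeasure μ]
    {p q : ℝ} (hp : 0 < p) (hpq : p < q) {C : ℝ≥0∞} (hCt : C < ⊤)
    (hC : ∀ f, MemHp n p f → ∫⁻ z, (‖f z‖₊ : ℝ≥0∞) ^ q ∂μ ≤ C * hNorm n p f ^ q) :
    IsSCarleson n (q / p) μ := by
  have hq : 0 < q := hp.trans hpq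
  have hs : 0 < q / p := by positivity
  obtain ⟨N, hN⟩ := exists_nat_gt (n / p : ℝ)
  rw [div_lt_iff₀ hp] at hN
  obtain ⟨A, hA, hnorm⟩ := exists_hNorm_inv_one_sub_herm_pow_le hn hp hN
  refine ⟨C * ENNReal.ofReal (2 ^ (N * q) * A ^ (q / p)) + μ univ, ENNReal.add_lt_top.2
    ⟨ENNReal.mul_lt_top hCt ENNReal.ofReal_lt_top, measure_lt_top _ _⟩, fun ζ hζ δ hδ => ?_⟩
  rw [add_mul]
  rcases le_or_gt 1 δ with h1 | h1
  · calc μ (cBox ζ δ) ≤ μ univ * 1 := by rw [mul_one]; exact measure_mono (subset_univ _)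
      _ ≤ μ univ * ENNReal.ofReal (δ ^ ((n : ℝ) * (q / p))) := by
          gcongr
          exact ENNReal.one_le_ofReal.2 (Real.one_le_rpow h1 (by positivity))
      _ ≤ _ := le_add_self
  refine le_add_right ?_
  set a := (1 - δ) • ζ with ha
  have hna : ‖a‖ = 1 - δ := by
    rw [ha, norm_smul, norm_of_mem_Sn hζ, mul_one, Real.norm_of_nonneg (by linarith)]
  have hb := hnorm a (mem_Bn.2 (by linarith))
  rw [hna, sub_sub_cancel] at hb
  have hf : MemHp n p fun w => (((1 : ℂ) - herm w a) ^ N)⁻¹ :=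
    ⟨differentiableOn_inv_one_sub_herm_pow (by linarith) N,
      hb.trans_lt (ENNReal.rpow_lt_top_of_nonneg (by positivity) ENNReal.ofReal_ne_top)⟩
  have hlow : ENNReal.ofReal ((2 * δ) ^ (-(N * q))) * μ (cBox ζ δ) ≤
      C * ENNReal.ofReal (A * δ ^ ((n : ℝ) - N * p)) ^ (q / p) :=
    calc _ = ∫⁻ _ in cBox ζ δ, ENNReal.ofReal ((2 * δ) ^ (-(N * q))) ∂μ :=
          (setLIntegral_const _ _).symm
      _ ≤ ∫⁻ z in cBox ζ δ, (‖(((1 : ℂ) - herm z a) ^ N)⁻¹‖₊ : ℝ≥0∞) ^ q ∂μ := by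
          refine setLIntegral_mono' (isOpen_cBox ζ δ).measurableSet fun z hz => ?_
          rw [nnnorm_inv_pow_rpow _ _ hq.le]
          refine ENNReal.ofReal_le_ofReal (Real.rpow_le_rpow_of_nonpos ?_
            (korDist_smul_lt_two_mul hζ hδ hz).le (by simp only [neg_nonpos]; positivity))
          have h2 := one_sub_norm_le_korDist (z := z) (ζ := a) (by linarith)
          have h3 := mem_Bn.1 hz.1
          unfold korDist at h2
          linarith
      _ ≤ _ := setLIntegral_le_lintegral _ _
      _ ≤ _ := hC _ hf
      _ ≤ C * (ENNReal.ofReal (A * δ ^ ((n : ℝ) - N * p)) ^ (1 / p)) ^ q := by gcongr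
      _ = _ := by rw [← ENNReal.rpow_mul, one_div_mul_eq_div]
  have hinv : ENNReal.ofReal ((2 * δ) ^ (N * q)) * ENNReal.ofReal ((2 * δ) ^ (-(N * q))) = 1 := by
    rw [← ENNReal.ofReal_mul (by positivity), ← Real.rpow_add (by positivity), add_neg_cancel,
      Real.rpow_zero, ENNReal.ofReal_one]
  calc μ (cBox ζ δ) = ENNReal.ofReal ((2 * δ) ^ (N * q)) *
        (ENNReal.ofReal ((2 * δ) ^ (-(N * q))) * μ (cBox ζ δ)) := by
        rw [← mul_assoc, hinv, one_mul]
    _ ≤ ENNReal.ofReal ((2 * δ) ^ (N * q)) *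
        (C * ENNReal.ofReal (A * δ ^ ((n : ℝ) - N * p)) ^ (q / p)) := by gcongr
    _ = _ := by
        rw [ENNReal.ofReal_rpow_of_nonneg (by positivity) hs.le, mul_left_comm, mul_assoc,
          ← ENNReal.ofReal_mul (by positivity), ← ENNReal.ofReal_mul (by positivity),
          Real.mul_rpow (by positivity) (by positivity), Real.mul_rpow (by positivity)
          (by positivity), ← Real.rpow_mul hδ.le]
        have hexp : (n : ℝ) * (q / p) = N * q + (n - N * p) * (q / p) := by field_simp; ring
        rw [hexp, Real.rpow_add hδ]
        congr 2; ring

end CarlesonNecessary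

/-- **Duren's theorem for the unit ball.** For a finite positive Borel
measure `μ` on `B_n` and `0 < p < q < ∞`, the embedding `H^p → L^q(μ)` is bounded iff `μ`
is a `q/p`-Carleson measure. -/
theorem stmt4 (n : ℕ) (hn : 1 ≤ n) (μ : Measure (En n)) [IsFiniteMeasure μ]
    (hμ : μ (Bn n)ᶜ = 0) (p q : ℝ) (hp : 0 < p) (hpq : p < q) :
    (∃ C : ℝ≥0∞, 0 < C ∧ C < ⊤ ∧
        ∀ f, MemHp n p f →
          ∫⁻ z, (‖f z‖₊ : ℝ≥0∞) ^ q ∂μ ≤ C * hNorm n p f ^ q) ↔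
      IsSCarleson n (q / p) μ :=
  ⟨fun ⟨_, _, hCt, h⟩ => isSCarleson_of_lintegral_le_hNorm hn hp hpq hCt h,
    fun h => exists_lintegral_le_hNorm_of_isSCarleson hn hμ hp hpq h⟩

end
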